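/- arXiv:1509.04790 — 2 statements merged into one kernel-verified Lean document; each statement's English description precedes it below -/
import Mathlib

section
/- The set 𝓑 = 𝓑₀ ∪ 𝓑₁ ∪ 𝓑₂ ∪ 𝓑₃ ∪ 𝓑₄ ∪ 𝓑₅ is linearly independent over K, and hence is a K-basis of MU_v(2) (the PBW basis), where 𝓑₀ = {f^r e^s k^t : r,s ≥ 0, t ∈ ℤ}, 𝓑₁ = {ℓ f^r e^s k^t : r,s ≥ 0, t ∈ ℤ}, 𝓑₂ = {f^r e^s ℓ k^t : r,s ≥ 0, (r,s) ≠ (0,0), t ∈ ℤ}, 𝓑₃ = {ℓ f^r e^s ℓ k^t : r,s ≥ 1, t ∈ ℤ}, 𝓑₄ = {f^r ℓ e^s k^t : r,s ≥ 1, t ∈ ℤ}, 𝓑₅ = {e^s ℓ f^r k^t : r,s ≥ 1, t ∈ ℤ} (all monomials listed in the six families being pairwise distinct basis vectors). -/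
namespace MirabolicSL2

noncomputable section

/-- The base field `K = ℂ(v)`. -/
abbrev K : Type := RatFunc ℂ

/-- The variable `v ∈ ℂ(v)`. -/
def vv : K := RatFunc.X

/-- The quantum integer `[m] = (v^m - v^{-m})/(v - v⁻¹)`. -/
def qn (m : ℤ) : K := (vv ^ m - vv ^ (-m)) / (vv - vv⁻¹)

/-- The five generators `e, f, k, k⁻¹, ℓ` of mirabolic quantum `sl₂`. -/
inductive G5 : Type | e | f | k | k' | l

open FreeAlgebra in
/-- The defining relations of mirabolic quantum `sl₂`. -/
inductive Rel : FreeAlgebra K G5 → FreeAlgebra K G5 → Prop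
  | kk'  : Rel (ι K G5.k * ι K G5.k') 1
  | k'k  : Rel (ι K G5.k' * ι K G5.k) 1
  | kek' : Rel (ι K G5.k * ι K G5.e * ι K G5.k') ((vv ^ 2) • ι K G5.e)
  | kfk' : Rel (ι K G5.k * ι K G5.f * ι K G5.k') ((vv ^ (-2 : ℤ)) • ι K G5.f)
  | effe : Rel (ι K G5.e * ι K G5.f - ι K G5.f * ι K G5.e)
      (((vv - vv⁻¹)⁻¹) • (ι K G5.k - ι K G5.k'))
  | ll   : Rel (ι K G5.l * ι K G5.l) (ι K G5.l)
  | kl   : Rel (ι K G5.k * ι K G5.l) (ι K G5.l * ι K G5.k)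
  | lel  : Rel (ι K G5.l * ι K G5.e * ι K G5.l) (ι K G5.l * ι K G5.e)
  | lfl  : Rel (ι K G5.l * ι K G5.f * ι K G5.l) (ι K G5.f * ι K G5.l)
  | serreE : Rel ((vv + vv⁻¹) • (ι K G5.e * ι K G5.l * ι K G5.e))
      (vv⁻¹ • (ι K G5.e * ι K G5.e * ι K G5.l) + vv • (ι K G5.l * (ι K G5.e * ι K G5.e)))
  | serreF : Rel ((vv + vv⁻¹) • (ι K G5.f * ι K G5.l * ι K G5.f))
      (vv⁻¹ • (ι K G5.l * (ι K G5.f * ι K G5.f)) + vv • (ι K G5.f * ι K G5.f * ι K G5.l))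

/-- Mirabolic quantum `sl₂`: the unital `K`-algebra presented by the generators
`e, f, k, k⁻¹, ℓ` and the relations `Rel`. -/
abbrev MU2 : Type := RingQuot Rel

/-- The generator `e` of `MU_v(2)`. -/
def Ee : MU2 := RingQuot.mkAlgHom K Rel (FreeAlgebra.ι K G5.e)
/-- The generator `f` of `MU_v(2)`. -/
def Ff : MU2 := RingQuot.mkAlgHom K Rel (FreeAlgebra.ι K G5.f)
/-- The generator `k` of `MU_v(2)`. -/
def Kk : MU2 := RingQuot.mkAlgHom K Rel (FreeAlgebra.ι K G5.k)
/-- The generator `k⁻¹` of `MU_v(2)`. -/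
def Kk' : MU2 := RingQuot.mkAlgHom K Rel (FreeAlgebra.ι K G5.k')
/-- The generator `ℓ` of `MU_v(2)`. -/
def Ll : MU2 := RingQuot.mkAlgHom K Rel (FreeAlgebra.ι K G5.l)

/-- `k^t` for `t ∈ ℤ` (the `(-t)`-th power of `k⁻¹` when `t < 0`). -/
def kzpow (t : ℤ) : MU2 := if 0 ≤ t then Kk ^ t.toNat else Kk' ^ (-t).toNat

/-- Validity of an index `(i, r, s, t)` for the `i`-th PBW family. -/
def pbwOK : Fin 6 × ℕ × ℕ × ℤ → Prop := fun p =>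
  if p.1 = 2 then (p.2.1, p.2.2.1) ≠ (0, 0)
  else if p.1 = 3 ∨ p.1 = 4 ∨ p.1 = 5 then 1 ≤ p.2.1 ∧ 1 ≤ p.2.2.1
  else True

/-- The family of all PBW monomials, indexed by the family number `i : Fin 6`,
the exponents `r s : ℕ`, `t : ℤ` (with the validity constraints). -/
def pbw : {p : Fin 6 × ℕ × ℕ × ℤ // pbwOK p} → MU2 := fun x =>
  let i := x.1.1; let r := x.1.2.1; let s := x.1.2.2.1; let t := x.1.2.2.2
  if i = 0 then Ff ^ r * Ee ^ s * kzpow t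
  else if i = 1 then Ll * Ff ^ r * Ee ^ s * kzpow t
  else if i = 2 then Ff ^ r * Ee ^ s * Ll * kzpow t
  else if i = 3 then Ll * Ff ^ r * Ee ^ s * Ll * kzpow t
  else if i = 4 then Ff ^ r * Ll * Ee ^ s * kzpow t
  else Ee ^ s * Ll * Ff ^ r * kzpow t

/-! ### Scalars -/

lemma vv_ne_zero : vv ≠ 0 := RatFunc.X_ne_zero

lemma vv_zpow_eq_one {n : ℤ} (h : vv ^ n = 1) : n = 0 := by
  have nat_case : ∀ m : ℕ, vv ^ m = 1 → m = 0 := by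
    intro m hm
    have h1 : algebraMap (Polynomial ℂ) (RatFunc ℂ) (Polynomial.X ^ m)
        = algebraMap (Polynomial ℂ) (RatFunc ℂ) 1 := by
      simpa [vv, RatFunc.algebraMap_X] using hm
    have h2 := congrArg Polynomial.natDegree (RatFunc.algebraMap_injective ℂ h1)
    simpa using h2
  obtain ⟨m, rfl | rfl⟩ := n.eq_nat_or_neg
  · simpa using nat_case m (by simpa using h)
  · simpa using nat_case m (by simpa using h)

lemma vv_sub_inv_ne_zero : vv - vv⁻¹ ≠ 0 := by
  intro h
  have h0 := vv_ne_zero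
  have : vv ^ (2 : ℤ) = 1 := by
    have h1 : vv = vv⁻¹ := sub_eq_zero.mp h
    calc vv ^ (2 : ℤ) = vv * vv := by rw [zpow_two]
      _ = vv * vv⁻¹ := by rw [← h1]
      _ = 1 := mul_inv_cancel₀ h0
  simpa using vv_zpow_eq_one this

/-- The quantum integer `[n]` for a natural number `n`, by recursion. -/
def qint : ℕ → K
  | 0 => 0
  | n + 1 => vv * qint n + vv ^ (-(n : ℤ))

/-- The geometric sum `1 + v⁻² + ⋯ + v^{-2(n-1)}`. -/
def geom : ℕ → K
  | 0 => 0
  | n + 1 => 1 + vv ^ (-2 : ℤ) * geom n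

lemma qint_mul (n : ℕ) : qint n * (vv - vv⁻¹) = vv ^ (n : ℤ) - vv ^ (-(n : ℤ)) := by
  have h0 := vv_ne_zero
  induction n with
  | zero => simp [qint]
  | succ n ih =>
    rw [qint, add_mul, mul_assoc, ih]
    push_cast
    rw [neg_add, zpow_add₀ h0, zpow_add₀ h0]
    field_simp
    ring

lemma qint_succ_ne_zero (n : ℕ) : qint (n + 1) ≠ 0 := by
  intro h
  have h0 := vv_ne_zero
  have h1 := qint_mul (n + 1)
  rw [h, zero_mul, eq_comm, sub_eq_zero] at h1
  have h2 : vv ^ (2 * ((n + 1 : ℕ) : ℤ)) = 1 := by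
    rw [two_mul, zpow_add₀ h0]
    nth_rewrite 1 [h1]
    rw [← zpow_add₀ h0]
    simp
  have := vv_zpow_eq_one h2
  omega

lemma qint_add_two (n : ℕ) : qint (n + 2) = (vv + vv⁻¹) * qint (n + 1) - qint n := by
  have h0 := vv_ne_zero
  simp only [qint]
  push_cast
  rw [neg_add, zpow_add₀ h0]
  field_simp
  ring

lemma geom_eq (n : ℕ) : geom n = vv * vv ^ (-(n : ℤ)) * qint n := by
  have h0 := vv_ne_zero
  induction n with
  | zero => simp [geom, qint]
  | succ n ih =>
    have key := qint_mul n
    rw [geom, qint, ih]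
    push_cast
    rw [zpow_neg, zpow_natCast] at *
    rw [neg_add, zpow_add₀ h0, zpow_neg, zpow_natCast]
    have hn : vv ^ n ≠ 0 := pow_ne_zero _ h0
    rw [zpow_neg_one]
    field_simp at key ⊢
    linear_combination (-1) * key

lemma geom_succ_ne_zero (n : ℕ) : geom (n + 1) ≠ 0 := by
  rw [geom_eq]
  exact mul_ne_zero (mul_ne_zero vv_ne_zero (zpow_ne_zero _ vv_ne_zero)) (qint_succ_ne_zero n)

/-! ### Quantum `sl₂` triples -/

lemma zpow_mul_pow_of_skew {A : Type*} [Ring A] [Algebra K A] {x : Aˣ} {y : A} {q : K}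
    (hq : q ≠ 0) (h : (x : A) * y = q • (y * x)) (t : ℤ) (s : ℕ) :
    ((x ^ t : Aˣ) : A) * y ^ s = q ^ (t * s) • (y ^ s * ((x ^ t : Aˣ) : A)) := by
  have hpow : (x : A) * y ^ s = q ^ s • (y ^ s * x) := by
    induction s with
    | zero => simp
    | succ s ih =>
      rw [pow_succ, ← mul_assoc, ih, smul_mul_assoc, mul_assoc, h, mul_smul_comm, smul_smul,
        pow_succ, mul_assoc]
  have hinv : ((x⁻¹ : Aˣ) : A) * y ^ s = (q ^ s)⁻¹ • (y ^ s * ((x⁻¹ : Aˣ) : A)) := by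
    rw [Units.inv_mul_eq_iff_eq_mul, mul_smul_comm, ← mul_assoc, hpow, smul_mul_assoc, smul_smul,
      inv_mul_cancel₀ (pow_ne_zero _ hq), one_smul, Units.mul_inv_cancel_right]
  induction t with
  | zero => simp
  | succ n ih =>
    rw [zpow_add_one, Units.val_mul, mul_assoc, hpow, mul_smul_comm, ← mul_assoc, ih,
      smul_mul_assoc, smul_smul, mul_assoc, add_mul, one_mul, zpow_add₀ hq, zpow_natCast q s,
      mul_comm (q ^ s)]
  | pred n ih =>
    rw [zpow_sub_one, Units.val_mul, mul_assoc, hinv, mul_smul_comm, ← mul_assoc, ih,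
      smul_mul_assoc, smul_smul, mul_assoc, sub_mul, one_mul, zpow_sub₀ hq, zpow_natCast q s,
      mul_comm (q ^ s)⁻¹, div_eq_mul_inv]

/-- `E, F, k` satisfy the defining relations of the quantum group of `sl₂`. -/
structure QTriple {A : Type*} [Ring A] [Algebra K A] (E F : A) (k : Aˣ) : Prop where
  kE : (k : A) * E = vv ^ (2 : ℤ) • (E * k)
  kF : (k : A) * F = vv ^ (-2 : ℤ) • (F * k)
  comm : E * F = F * E + (vv - vv⁻¹)⁻¹ • ((k : A) - ((k⁻¹ : Aˣ) : A))

namespace QTriple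

variable {A : Type*} [Ring A] [Algebra K A] {E F : A} {k : Aˣ}

lemma zpow_mul_E_pow (h : QTriple E F k) (t : ℤ) (s : ℕ) :
    ((k ^ t : Aˣ) : A) * E ^ s = vv ^ (2 * (t * s)) • (E ^ s * ((k ^ t : Aˣ) : A)) := by
  rw [zpow_mul_pow_of_skew (zpow_ne_zero _ vv_ne_zero) h.kE, ← zpow_mul]

lemma zpow_mul_F_pow (h : QTriple E F k) (t : ℤ) (s : ℕ) :
    ((k ^ t : Aˣ) : A) * F ^ s = vv ^ (-2 * (t * s)) • (F ^ s * ((k ^ t : Aˣ) : A)) := by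
  rw [zpow_mul_pow_of_skew (zpow_ne_zero _ vv_ne_zero) h.kF, ← zpow_mul]

lemma inv_mul_E (h : QTriple E F k) :
    ((k⁻¹ : Aˣ) : A) * E = vv ^ (-2 : ℤ) • (E * ((k⁻¹ : Aˣ) : A)) := by
  simpa using h.zpow_mul_E_pow (-1) 1

lemma inv_mul_F (h : QTriple E F k) :
    ((k⁻¹ : Aˣ) : A) * F = vv ^ (2 : ℤ) • (F * ((k⁻¹ : Aˣ) : A)) := by
  simpa using h.zpow_mul_F_pow (-1) 1

/-- The Chevalley involution, exchanging `E` and `F`. -/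
lemma swap (h : QTriple E F k) : QTriple F E k⁻¹ where
  kE := h.inv_mul_F
  kF := h.inv_mul_E
  comm := by
    rw [h.comm, inv_inv, add_assoc, ← smul_add]
    simp

lemma E_mul_F_pow_succ (h : QTriple E F k) (r : ℕ) : ∃ a b : K,
    E * F ^ (r + 1) = F ^ (r + 1) * E + F ^ r * (a • (k : A) + b • ((k⁻¹ : Aˣ) : A)) := by
  induction r with
  | zero =>
    refine ⟨(vv - vv⁻¹)⁻¹, -(vv - vv⁻¹)⁻¹, ?_⟩
    simp [h.comm, sub_eq_add_neg]
  | succ r ih =>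
    obtain ⟨a, b, hab⟩ := ih
    refine ⟨(vv - vv⁻¹)⁻¹ + a * vv ^ (-2 : ℤ), -(vv - vv⁻¹)⁻¹ + b * vv ^ (2 : ℤ), ?_⟩
    rw [pow_succ F (r + 1), ← mul_assoc, hab, add_mul, mul_assoc, mul_assoc, add_mul, h.comm,
      smul_mul_assoc, smul_mul_assoc, h.kF, h.inv_mul_F]
    simp only [mul_add, mul_smul_comm, add_smul, smul_sub, mul_sub, neg_smul, mul_neg, mul_smul,
      ← mul_assoc, ← pow_succ]
    abel

/-- The subspace spanned by the PBW monomials `F ^ r * E ^ s * k ^ t`. -/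
def pbwSpan (E F : A) (k : Aˣ) : Submodule K A :=
  Submodule.span K (Set.range fun p : ℕ × ℕ × ℤ => F ^ p.1 * E ^ p.2.1 * ((k ^ p.2.2 : Aˣ) : A))

lemma mem_pbwSpan (E F : A) (k : Aˣ) (r s : ℕ) (t : ℤ) :
    F ^ r * E ^ s * ((k ^ t : Aˣ) : A) ∈ pbwSpan E F k :=
  Submodule.subset_span ⟨(r, s, t), rfl⟩

lemma E_mul_mem_pbwSpan (h : QTriple E F k) {x : A} (hx : x ∈ pbwSpan E F k) :
    E * x ∈ pbwSpan E F k := by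
  induction hx using Submodule.span_induction with
  | mem x hx =>
    obtain ⟨⟨r, s, t⟩, rfl⟩ := hx
    rcases r with _ | r
    · simpa [pow_succ', mul_assoc] using mem_pbwSpan E F k 0 (s + 1) t
    · obtain ⟨a, b, hab⟩ := h.E_mul_F_pow_succ r
      have hk (c : ℤ) : F ^ r * (((k ^ c : Aˣ) : A) * (E ^ s * ((k ^ t : Aˣ) : A)))
          ∈ pbwSpan E F k := by
        rw [← mul_assoc ((k ^ c : Aˣ) : A), h.zpow_mul_E_pow, smul_mul_assoc, mul_smul_comm,
          mul_assoc (E ^ s), ← Units.val_mul, ← zpow_add, ← mul_assoc (F ^ r)]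
        exact Submodule.smul_mem _ _ (mem_pbwSpan _ _ _ _ _ _)
      have e1 := hk 1
      have e2 := hk (-1)
      rw [zpow_one] at e1
      rw [zpow_neg_one] at e2
      dsimp only
      rw [← mul_assoc, ← mul_assoc, hab]
      simp only [add_mul, mul_add, mul_smul_comm, smul_mul_assoc, mul_assoc]
      refine add_mem ?_ (add_mem (Submodule.smul_mem _ _ e1) (Submodule.smul_mem _ _ e2))
      simpa only [pow_succ' E, mul_assoc] using mem_pbwSpan E F k (r + 1) (s + 1) t
  | zero => simp
  | add x y _ _ hx hy => rw [mul_add]; exact add_mem hx hy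
  | smul a x _ hx => rw [mul_smul_comm]; exact Submodule.smul_mem _ _ hx

lemma swapped_mem_pbwSpan (h : QTriple E F k) (r s : ℕ) (t : ℤ) :
    E ^ s * F ^ r * ((k ^ t : Aˣ) : A) ∈ pbwSpan E F k := by
  induction s with
  | zero => simpa using mem_pbwSpan E F k r 0 t
  | succ s ih =>
    rw [pow_succ', mul_assoc, mul_assoc, ← mul_assoc (E ^ s)]
    exact h.E_mul_mem_pbwSpan ih

/-- A linear map sending the monomials `F ^ r * E ^ s * k ^ t` into a subspace also sends the
monomials `E ^ s * F ^ r * k ^ t` into it. -/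
lemma map_swapped_mem (h : QTriple E F k) {S : Submodule K A} (T : A →ₗ[K] A)
    (hT : ∀ (r s : ℕ) (t : ℤ), T (F ^ r * E ^ s * ((k ^ t : Aˣ) : A)) ∈ S) (r s : ℕ) (t : ℤ) :
    T (E ^ s * F ^ r * ((k ^ t : Aˣ) : A)) ∈ S := by
  have hle : pbwSpan E F k ≤ S.comap T :=
    Submodule.span_le.mpr (by rintro _ ⟨⟨r, s, t⟩, rfl⟩; exact hT r s t)
  exact hle (h.swapped_mem_pbwSpan r s t)

/-- A linear map sending the monomials `E ^ s * F ^ r * k ^ t` into a subspace also sends the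
monomials `F ^ r * E ^ s * k ^ t` into it. -/
lemma map_mem_of_swapped (h : QTriple E F k) {S : Submodule K A} (T : A →ₗ[K] A)
    (hT : ∀ (r s : ℕ) (t : ℤ), T (E ^ s * F ^ r * ((k ^ t : Aˣ) : A)) ∈ S) (r s : ℕ) (t : ℤ) :
    T (F ^ r * E ^ s * ((k ^ t : Aˣ) : A)) ∈ S := by
  have := h.swap.map_swapped_mem T (fun s r t => by simpa using hT r s (-t)) s r (-t)
  simpa using this

end QTriple

/-- The higher form of the relation `[2] x ℓ x = q⁻¹ x² ℓ + q ℓ x²`. -/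
lemma serre_pow {A : Type*} [Ring A] [Algebra K A] {x l : A} {q : K} {a : ℕ → K} (hq : q ≠ 0)
    (h : (q + q⁻¹) • (x * l * x) = q⁻¹ • (x * x * l) + q • (l * (x * x)))
    (h0 : a 0 = 0) (h1 : a 1 = 1) (h2 : ∀ n, a (n + 2) = (q + q⁻¹) * a (n + 1) - a n) (n : ℕ) :
    a (n + 1) • (x * l * x ^ n)
      = (q⁻¹ ^ n) • (x ^ (n + 1) * l) + (q * a n) • (l * x ^ (n + 1)) := by
  induction n with
  | zero =>
    simp only [zero_add, h0, h1, pow_zero, pow_one, mul_zero, zero_smul, add_zero, mul_one]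
  | succ n ih =>
    have hl : (q + q⁻¹) • (x * l * x ^ (n + 1))
        = q⁻¹ • (x * (x * l * x ^ n)) + q • (l * x ^ (n + 2)) := by
      have := congrArg (· * x ^ n) h
      rw [pow_succ' x (n + 1), pow_succ' x n]
      simpa only [smul_mul_assoc, add_mul, mul_assoc] using this
    have hx := congrArg (x * ·) ih
    simp only [mul_add, mul_smul_comm] at hx
    have e1 : x * (x ^ (n + 1) * l) = x ^ (n + 2) * l := by rw [← mul_assoc, ← pow_succ']
    have e2 : x * (l * x ^ (n + 1)) = x * l * x ^ (n + 1) := by rw [mul_assoc]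
    rw [e1, e2] at hx
    have hl' := congrArg (a (n + 1) • ·) hl
    simp only [smul_add, smul_comm (a (n + 1)) q⁻¹, hx] at hl'
    rw [show n + 1 + 1 = n + 2 from rfl, h2, sub_smul, mul_comm (q + q⁻¹), mul_smul, hl']
    rw [smul_smul q⁻¹ (q * a n), inv_mul_cancel_left₀ hq, smul_smul q⁻¹, ← pow_succ',
      smul_smul (a (n + 1)) q, mul_comm (a (n + 1)) q]
    abel

/-! ### The mirabolic relations -/

/-- `E, F, k, L` satisfy the defining relations of `MU_v(2)`. -/
structure IsMirabolic {A : Type*} [Ring A] [Algebra K A] (E F : A) (k : Aˣ) (L : A) : Prop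
    extends QTriple E F k where
  ll : L * L = L
  kl : (k : A) * L = L * k
  lel : L * E * L = L * E
  lfl : L * F * L = F * L
  serreE : (vv + vv⁻¹) • (E * L * E) = vv⁻¹ • (E * E * L) + vv • (L * (E * E))
  serreF : (vv + vv⁻¹) • (F * L * F) = vv⁻¹ • (L * (F * F)) + vv • (F * F * L)

namespace IsMirabolic

variable {A : Type*} [Ring A] [Algebra K A] {E F L : A} {k : Aˣ}

lemma zpow_mul_L (h : IsMirabolic E F k L) (t : ℤ) :
    ((k ^ t : Aˣ) : A) * L = L * ((k ^ t : Aˣ) : A) :=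
  (Commute.units_zpow_left (show Commute (k : A) L from h.kl) t).eq

lemma L_mul_E_pow_mul_L (h : IsMirabolic E F k L) (s : ℕ) : L * (E ^ s * L) = L * E ^ s := by
  induction s with
  | zero => simp [h.ll]
  | succ s ih =>
    calc L * (E ^ (s + 1) * L) = L * E ^ s * (E * L) := by simp only [pow_succ, mul_assoc]
      _ = L * (E ^ s * L) * (E * L) := by rw [ih]
      _ = L * E ^ s * (L * E * L) := by simp only [mul_assoc]
      _ = L * (E ^ s * L) * E := by rw [h.lel]; simp only [mul_assoc]
      _ = L * E ^ (s + 1) := by rw [ih, pow_succ, mul_assoc]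

lemma L_mul_F_pow_mul_L (h : IsMirabolic E F k L) (r : ℕ) : L * (F ^ r * L) = F ^ r * L := by
  induction r with
  | zero => simp [h.ll]
  | succ r ih =>
    calc L * (F ^ (r + 1) * L) = L * F * (F ^ r * L) := by simp only [pow_succ', mul_assoc]
      _ = L * F * (L * (F ^ r * L)) := by rw [ih]
      _ = L * F * L * (F ^ r * L) := by simp only [mul_assoc]
      _ = F * (L * (F ^ r * L)) := by rw [h.lfl]; simp only [mul_assoc]
      _ = F ^ (r + 1) * L := by rw [ih, pow_succ', mul_assoc]

lemma E_mul_L_mul_E_pow (h : IsMirabolic E F k L) (s : ℕ) :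
    ∃ a b : K, E * (L * E ^ s) = a • (E ^ (s + 1) * L) + b • (L * E ^ (s + 1)) := by
  have key := serre_pow vv_ne_zero h.serreE (a := qint) rfl (by simp [qint]) qint_add_two s
  refine ⟨(qint (s + 1))⁻¹ * vv⁻¹ ^ s, (qint (s + 1))⁻¹ * (vv * qint s), ?_⟩
  rw [mul_smul, mul_smul, ← smul_add, ← key, inv_smul_smul₀ (qint_succ_ne_zero s), mul_assoc]

lemma F_mul_L_mul_F_pow (h : IsMirabolic E F k L) (r : ℕ) :
    ∃ a b : K, F * (L * F ^ r) = a • (F ^ (r + 1) * L) + b • (L * F ^ (r + 1)) := by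
  have hF : (vv⁻¹ + vv⁻¹⁻¹) • (F * L * F) = vv⁻¹⁻¹ • (F * F * L) + vv⁻¹ • (L * (F * F)) := by
    rw [inv_inv, add_comm, h.serreF, add_comm]
  have key := serre_pow (inv_ne_zero vv_ne_zero) hF (a := qint) rfl (by simp [qint])
    (fun n => by rw [inv_inv, add_comm vv⁻¹, qint_add_two]) r
  refine ⟨(qint (r + 1))⁻¹ * vv⁻¹⁻¹ ^ r, (qint (r + 1))⁻¹ * (vv⁻¹ * qint r), ?_⟩
  rw [mul_smul, mul_smul, ← smul_add, ← key, inv_smul_smul₀ (qint_succ_ne_zero r), mul_assoc]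

end IsMirabolic

/-! ### The PBW monomials span -/

/-- The generator `k` as a unit of `MU_v(2)`. -/
def kUnit : MU2ˣ where
  val := Kk
  inv := Kk'
  val_inv := by simpa only [map_mul, map_one, Kk, Kk'] using RingQuot.mkAlgHom_rel K Rel.kk'
  inv_val := by simpa only [map_mul, map_one, Kk, Kk'] using RingQuot.mkAlgHom_rel K Rel.k'k

lemma kzpow_eq (t : ℤ) : kzpow t = ((kUnit ^ t : MU2ˣ) : MU2) := by
  obtain ⟨n, rfl | rfl⟩ := t.eq_nat_or_neg
  · simp [kzpow, kUnit]
  · rcases n with _ | n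
    · simp [kzpow]
    · have h : ¬ (0 : ℤ) ≤ -((n + 1 : ℕ) : ℤ) := by omega
      rw [kzpow, if_neg h, neg_neg, Int.toNat_natCast, zpow_neg, zpow_natCast, ← inv_pow,
        Units.val_pow_eq_pow_val]
      rfl

lemma isMirabolic : IsMirabolic Ee Ff kUnit Ll where
  kE := by
    have h : Kk * Ee * Kk' = vv ^ 2 • Ee := by
      simpa only [map_mul, map_smul, Kk, Kk', Ee] using RingQuot.mkAlgHom_rel K Rel.kek'
    calc Kk * Ee = Kk * Ee * Kk' * Kk := (Units.inv_mul_cancel_right _ kUnit).symm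
      _ = _ := by rw [h, smul_mul_assoc]; rfl
  kF := by
    have h : Kk * Ff * Kk' = vv ^ (-2 : ℤ) • Ff := by
      simpa only [map_mul, map_smul, Kk, Kk', Ff] using RingQuot.mkAlgHom_rel K Rel.kfk'
    calc Kk * Ff = Kk * Ff * Kk' * Kk := (Units.inv_mul_cancel_right _ kUnit).symm
      _ = _ := by rw [h, smul_mul_assoc]; rfl
  comm := by
    have h := RingQuot.mkAlgHom_rel K Rel.effe
    simp only [map_sub, map_mul, map_smul] at h
    exact sub_eq_iff_eq_add'.mp h
  ll := by simpa only [map_mul, Ll] using RingQuot.mkAlgHom_rel K Rel.ll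
  kl := by
    have h := RingQuot.mkAlgHom_rel K Rel.kl
    simp only [map_mul] at h
    exact h
  lel := by simpa only [map_mul, Ll, Ee] using RingQuot.mkAlgHom_rel K Rel.lel
  lfl := by simpa only [map_mul, Ll, Ff] using RingQuot.mkAlgHom_rel K Rel.lfl
  serreE := by
    simpa only [map_mul, map_add, map_smul, Ll, Ee] using RingQuot.mkAlgHom_rel K Rel.serreE
  serreF := by
    simpa only [map_mul, map_add, map_smul, Ll, Ff] using RingQuot.mkAlgHom_rel K Rel.serreF

/-- The span of the PBW monomials of `MU_v(2)`. -/
abbrev S : Submodule K MU2 := Submodule.span K (Set.range pbw)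

local notation "kPow(" t ")" => ((kUnit ^ (t : ℤ) : MU2ˣ) : MU2)

lemma zpow_mul_zpow_kUnit (c t : ℤ) : kPow(c) * kPow(t) = kPow(c + t) := by
  rw [← Units.val_mul, ← zpow_add]

lemma FE_mem (r s : ℕ) (t : ℤ) : Ff ^ r * (Ee ^ s * kPow(t)) ∈ S :=
  Submodule.subset_span ⟨⟨(0, r, s, t), by simp [pbwOK]⟩, by simp [pbw, kzpow_eq, mul_assoc]⟩

lemma LFE_mem (r s : ℕ) (t : ℤ) : Ll * (Ff ^ r * (Ee ^ s * kPow(t))) ∈ S :=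
  Submodule.subset_span ⟨⟨(1, r, s, t), by simp [pbwOK]⟩, by simp [pbw, kzpow_eq, mul_assoc]⟩

lemma FEL_mem (r s : ℕ) (t : ℤ) : Ff ^ r * (Ee ^ s * (Ll * kPow(t))) ∈ S := by
  by_cases h : (r, s) = (0, 0)
  · obtain ⟨rfl, rfl⟩ := Prod.mk.inj h
    simpa using LFE_mem 0 0 t
  · exact Submodule.subset_span
      ⟨⟨(2, r, s, t), by simpa [pbwOK] using h⟩, by simp [pbw, kzpow_eq, mul_assoc]⟩

lemma LFEL_mem (r s : ℕ) (t : ℤ) : Ll * (Ff ^ r * (Ee ^ s * (Ll * kPow(t)))) ∈ S := by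
  rcases r with _ | r
  · have h := LFE_mem 0 s t
    rw [pow_zero, one_mul, ← mul_assoc, ← isMirabolic.L_mul_E_pow_mul_L] at h
    simpa only [pow_zero, one_mul, mul_assoc] using h
  rcases s with _ | s
  · have h := FEL_mem (r + 1) 0 t
    rw [pow_zero, one_mul, ← mul_assoc, ← isMirabolic.L_mul_F_pow_mul_L] at h
    simpa only [pow_zero, one_mul, mul_assoc] using h
  · exact Submodule.subset_span
      ⟨⟨(3, r + 1, s + 1, t), by simp [pbwOK]⟩, by simp [pbw, kzpow_eq, mul_assoc]⟩

lemma FLE_mem (r s : ℕ) (t : ℤ) : Ff ^ r * (Ll * (Ee ^ s * kPow(t))) ∈ S := by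
  rcases r with _ | r
  · simpa using LFE_mem 0 s t
  rcases s with _ | s
  · simpa using FEL_mem (r + 1) 0 t
  · exact Submodule.subset_span
      ⟨⟨(4, r + 1, s + 1, t), by simp [pbwOK]⟩, by simp [pbw, kzpow_eq, mul_assoc]⟩

lemma ELF_mem (r s : ℕ) (t : ℤ) : Ee ^ s * (Ll * (Ff ^ r * kPow(t))) ∈ S := by
  rcases r with _ | r
  · simpa using FEL_mem 0 s t
  rcases s with _ | s
  · simpa using LFE_mem (r + 1) 0 t
  · exact Submodule.subset_span
      ⟨⟨(5, r + 1, s + 1, t), by simp [pbwOK]⟩, by simp [pbw, kzpow_eq, mul_assoc]⟩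

lemma L_mul_zpow (t : ℤ) : Ll * kPow(t) = kPow(t) * Ll := (isMirabolic.zpow_mul_L t).symm

lemma LEF_mem (r s : ℕ) (t : ℤ) : Ll * (Ee ^ s * (Ff ^ r * kPow(t))) ∈ S := by
  simpa [mul_assoc] using isMirabolic.map_swapped_mem (S := S) (LinearMap.mulLeft K Ll)
    (fun r s t => by simpa [mul_assoc] using LFE_mem r s t) r s t

lemma EFL_mem (r s : ℕ) (t : ℤ) : Ee ^ s * (Ff ^ r * (Ll * kPow(t))) ∈ S := by
  simpa [mul_assoc, L_mul_zpow] using isMirabolic.map_swapped_mem (S := S)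
    (LinearMap.mulRight K Ll)
    (fun r s t => by simpa [mul_assoc, L_mul_zpow] using FEL_mem r s t) r s t

lemma LEFL_mem (r s : ℕ) (t : ℤ) : Ll * (Ee ^ s * (Ff ^ r * (Ll * kPow(t)))) ∈ S := by
  simpa [mul_assoc, L_mul_zpow] using isMirabolic.map_swapped_mem (S := S)
    (LinearMap.mulLeft K Ll ∘ₗ LinearMap.mulRight K Ll)
    (fun r s t => by simpa [mul_assoc, L_mul_zpow] using LFEL_mem r s t) r s t

/-- A linear map sending each PBW monomial into the span of the PBW monomials preserves this
span. -/
lemma map_S_le (T : MU2 →ₗ[K] MU2)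
    (h0 : ∀ (r s : ℕ) (t : ℤ), T (Ff ^ r * (Ee ^ s * kPow(t))) ∈ S)
    (h1 : ∀ (r s : ℕ) (t : ℤ), T (Ll * (Ff ^ r * (Ee ^ s * kPow(t)))) ∈ S)
    (h2 : ∀ (r s : ℕ) (t : ℤ), T (Ff ^ r * (Ee ^ s * (Ll * kPow(t)))) ∈ S)
    (h3 : ∀ (r s : ℕ) (t : ℤ), T (Ll * (Ff ^ r * (Ee ^ s * (Ll * kPow(t))))) ∈ S)
    (h4 : ∀ (r s : ℕ) (t : ℤ), T (Ff ^ r * (Ll * (Ee ^ s * kPow(t)))) ∈ S)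
    (h5 : ∀ (r s : ℕ) (t : ℤ), T (Ee ^ s * (Ll * (Ff ^ r * kPow(t)))) ∈ S) :
    ∀ x ∈ S, T x ∈ S := by
  have hle : S ≤ S.comap T := by
    refine Submodule.span_le.mpr ?_
    rintro _ ⟨⟨⟨i, r, s, t⟩, hi⟩, rfl⟩
    rw [SetLike.mem_coe, Submodule.mem_comap]
    fin_cases i
    · simpa [pbw, kzpow_eq, mul_assoc] using h0 r s t
    · simpa [pbw, kzpow_eq, mul_assoc] using h1 r s t
    · simpa [pbw, kzpow_eq, mul_assoc] using h2 r s t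
    · simpa [pbw, kzpow_eq, mul_assoc] using h3 r s t
    · simpa [pbw, kzpow_eq, mul_assoc] using h4 r s t
    · simpa [pbw, kzpow_eq, mul_assoc] using h5 r s t
  exact hle

lemma zpow_mul_F_pow_mul (c : ℤ) (r : ℕ) (x : MU2) :
    kPow(c) * (Ff ^ r * x) = vv ^ (-2 * (c * r)) • (Ff ^ r * (kPow(c) * x)) := by
  rw [← mul_assoc, isMirabolic.zpow_mul_F_pow, smul_mul_assoc, mul_assoc]

lemma zpow_mul_E_pow_mul (c : ℤ) (s : ℕ) (x : MU2) :
    kPow(c) * (Ee ^ s * x) = vv ^ (2 * (c * s)) • (Ee ^ s * (kPow(c) * x)) := by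
  rw [← mul_assoc, isMirabolic.zpow_mul_E_pow, smul_mul_assoc, mul_assoc]

lemma zpow_mul_L_mul (c : ℤ) (x : MU2) : kPow(c) * (Ll * x) = Ll * (kPow(c) * x) := by
  rw [← mul_assoc, isMirabolic.zpow_mul_L, mul_assoc]

lemma zpow_mul_mem_S (c : ℤ) : ∀ x ∈ S, kPow(c) * x ∈ S := by
  apply map_S_le (LinearMap.mulLeft K kPow(c)) <;> intro r s t <;>
    simp only [LinearMap.mulLeft_apply, zpow_mul_F_pow_mul, zpow_mul_E_pow_mul, zpow_mul_L_mul,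
      zpow_mul_zpow_kUnit, mul_smul_comm]
  · exact S.smul_mem _ (S.smul_mem _ (FE_mem _ _ _))
  · exact S.smul_mem _ (S.smul_mem _ (LFE_mem _ _ _))
  · exact S.smul_mem _ (S.smul_mem _ (FEL_mem _ _ _))
  · exact S.smul_mem _ (S.smul_mem _ (LFEL_mem _ _ _))
  · exact S.smul_mem _ (S.smul_mem _ (FLE_mem _ _ _))
  · exact S.smul_mem _ (S.smul_mem _ (ELF_mem _ _ _))

lemma L_mul_mem_S : ∀ x ∈ S, Ll * x ∈ S := by
  have hll (x : MU2) : Ll * (Ll * x) = Ll * x := by rw [← mul_assoc, isMirabolic.ll]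
  have hF (r : ℕ) (x : MU2) : Ll * (Ff ^ r * (Ll * x)) = Ff ^ r * (Ll * x) := by
    simpa only [mul_assoc] using congrArg (· * x) (isMirabolic.L_mul_F_pow_mul_L r)
  have hE (s : ℕ) (x : MU2) : Ll * (Ee ^ s * (Ll * x)) = Ll * (Ee ^ s * x) := by
    simpa only [mul_assoc] using congrArg (· * x) (isMirabolic.L_mul_E_pow_mul_L s)
  apply map_S_le (LinearMap.mulLeft K Ll) <;> intro r s t <;>
    simp only [LinearMap.mulLeft_apply, hll, hF, hE]
  · exact LFE_mem _ _ _
  · exact LFE_mem _ _ _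
  · exact LFEL_mem _ _ _
  · exact LFEL_mem _ _ _
  · exact FLE_mem _ _ _
  · exact LEF_mem _ _ _

lemma E_mul_mem_S : ∀ x ∈ S, Ee * x ∈ S := by
  have hELE (s : ℕ) (x : MU2) (h1 : Ee ^ (s + 1) * (Ll * x) ∈ S)
      (h2 : Ll * (Ee ^ (s + 1) * x) ∈ S) : Ee * (Ll * (Ee ^ s * x)) ∈ S := by
    obtain ⟨a, b, hab⟩ := isMirabolic.E_mul_L_mul_E_pow s
    have h := congrArg (· * x) hab
    simp only [add_mul, smul_mul_assoc, mul_assoc] at h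
    rw [h]
    exact add_mem (S.smul_mem _ h1) (S.smul_mem _ h2)
  have hEF (r : ℕ) (x : MU2) (h1 : Ff ^ (r + 1) * (Ee * x) ∈ S)
      (h2 : ∀ c : ℤ, Ff ^ r * (kPow(c) * x) ∈ S) : Ee * (Ff ^ (r + 1) * x) ∈ S := by
    obtain ⟨a, b, hab⟩ := isMirabolic.E_mul_F_pow_succ r
    have h := congrArg (· * x) hab
    simp only [add_mul, mul_add, mul_smul_comm, smul_mul_assoc, mul_assoc] at h
    rw [h]
    exact add_mem h1 (add_mem (S.smul_mem _ (by simpa using h2 1))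
      (S.smul_mem _ (by simpa using h2 (-1))))
  apply map_S_le (LinearMap.mulLeft K Ee)
  · rintro (_ | r) s t
    · simpa [pow_succ', mul_assoc] using FE_mem 0 (s + 1) t
    · refine hEF r _ ?_ fun c => ?_
      · simpa only [pow_succ' Ee, mul_assoc] using FE_mem (r + 1) (s + 1) t
      · rw [zpow_mul_E_pow_mul, zpow_mul_zpow_kUnit, mul_smul_comm]
        exact S.smul_mem _ (FE_mem _ _ _)
  · intro r s t
    simpa [mul_assoc] using isMirabolic.map_mem_of_swapped (S := S)
      (LinearMap.mulLeft K Ee ∘ₗ LinearMap.mulLeft K Ll)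
      (fun r s t => by
        simpa [mul_assoc] using hELE s (Ff ^ r * kPow(t)) (ELF_mem _ _ _) (LEF_mem _ _ _)) r s t
  · rintro (_ | r) s t
    · simpa [pow_succ', mul_assoc] using FEL_mem 0 (s + 1) t
    · refine hEF r _ ?_ fun c => ?_
      · simpa only [pow_succ' Ee, mul_assoc] using FEL_mem (r + 1) (s + 1) t
      · rw [zpow_mul_E_pow_mul, zpow_mul_L_mul, zpow_mul_zpow_kUnit, mul_smul_comm]
        exact S.smul_mem _ (FEL_mem _ _ _)
  · intro r s t
    simpa [mul_assoc, L_mul_zpow] using isMirabolic.map_mem_of_swapped (S := S)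
      (LinearMap.mulLeft K Ee ∘ₗ LinearMap.mulLeft K Ll ∘ₗ LinearMap.mulRight K Ll)
      (fun r s t => by
        have h1 := EFL_mem r (s + 1) t
        rw [← mul_assoc (Ff ^ r), ← isMirabolic.L_mul_F_pow_mul_L] at h1
        simpa [mul_assoc, L_mul_zpow] using hELE s (Ff ^ r * (Ll * kPow(t)))
          (by simpa only [mul_assoc] using h1) (LEFL_mem _ _ _)) r s t
  · rintro (_ | r) s t
    · simpa using hELE s kPow(t) (by simpa using FEL_mem 0 (s + 1) t)
        (by simpa using LFE_mem 0 (s + 1) t)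
    · refine hEF r _ ?_ fun c => ?_
      · obtain ⟨a, b, hab⟩ := isMirabolic.E_mul_L_mul_E_pow s
        have h := congrArg (· * kPow(t)) hab
        simp only [add_mul, smul_mul_assoc, mul_assoc] at h
        rw [h, mul_add, mul_smul_comm, mul_smul_comm]
        exact add_mem (S.smul_mem _ (FEL_mem _ _ _)) (S.smul_mem _ (FLE_mem _ _ _))
      · rw [zpow_mul_L_mul, zpow_mul_E_pow_mul, zpow_mul_zpow_kUnit, mul_smul_comm, mul_smul_comm]
        exact S.smul_mem _ (FLE_mem _ _ _)
  · intro r s t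
    simpa only [LinearMap.mulLeft_apply, pow_succ', mul_assoc] using ELF_mem r (s + 1) t

lemma F_mul_mem_S : ∀ x ∈ S, Ff * x ∈ S := by
  have hFLF (r : ℕ) (x : MU2) (h1 : Ff ^ (r + 1) * (Ll * x) ∈ S)
      (h2 : Ll * (Ff ^ (r + 1) * x) ∈ S) : Ff * (Ll * (Ff ^ r * x)) ∈ S := by
    obtain ⟨a, b, hab⟩ := isMirabolic.F_mul_L_mul_F_pow r
    have h := congrArg (· * x) hab
    simp only [add_mul, smul_mul_assoc, mul_assoc] at h
    rw [h]
    exact add_mem (S.smul_mem _ h1) (S.smul_mem _ h2)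
  apply map_S_le (LinearMap.mulLeft K Ff) <;> intro r s t
  · simpa only [LinearMap.mulLeft_apply, pow_succ', mul_assoc] using FE_mem (r + 1) s t
  · exact hFLF r _ (FLE_mem _ _ _) (LFE_mem _ _ _)
  · simpa only [LinearMap.mulLeft_apply, pow_succ', mul_assoc] using FEL_mem (r + 1) s t
  · refine hFLF r _ ?_ (LFEL_mem _ _ _)
    have h := FLE_mem (r + 1) s t
    rw [← mul_assoc Ll, ← isMirabolic.L_mul_E_pow_mul_L] at h
    simpa only [mul_assoc] using h
  · simpa only [LinearMap.mulLeft_apply, pow_succ', mul_assoc] using FLE_mem (r + 1) s t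
  · rcases s with _ | s
    · simpa using hFLF r kPow(t) (by simpa using FEL_mem (r + 1) 0 t)
        (by simpa using LFE_mem (r + 1) 0 t)
    · obtain ⟨a, b, hab⟩ := isMirabolic.swap.E_mul_F_pow_succ s
      have h := congrArg (· * (Ll * (Ff ^ r * kPow(t)))) hab
      simp only [add_mul, mul_add, mul_smul_comm, smul_mul_assoc, mul_assoc, inv_inv] at h
      have hk (c : ℤ) : Ee ^ s * (kPow(c) * (Ll * (Ff ^ r * kPow(t)))) ∈ S := by
        rw [zpow_mul_L_mul, zpow_mul_F_pow_mul, zpow_mul_zpow_kUnit, mul_smul_comm, mul_smul_comm]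
        exact S.smul_mem _ (ELF_mem _ _ _)
      rw [LinearMap.mulLeft_apply, h]
      refine add_mem ?_ (add_mem (S.smul_mem _ (by simpa using hk (-1)))
        (S.smul_mem _ (by simpa using hk 1)))
      obtain ⟨a, b, hab⟩ := isMirabolic.F_mul_L_mul_F_pow r
      have h := congrArg (· * kPow(t)) hab
      simp only [add_mul, smul_mul_assoc, mul_assoc] at h
      rw [h, mul_add, mul_smul_comm, mul_smul_comm]
      exact add_mem (S.smul_mem _ (EFL_mem _ _ _)) (S.smul_mem _ (ELF_mem _ _ _))

lemma span_pbw_eq_top : S = ⊤ := by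
  have hmul (a : FreeAlgebra K G5) : ∀ x ∈ S, RingQuot.mkAlgHom K Rel a * x ∈ S := by
    induction a using FreeAlgebra.induction with
    | grade0 c =>
      intro x hx
      rw [AlgHom.commutes, ← Algebra.smul_def]
      exact S.smul_mem _ hx
    | grade1 g =>
      cases g with
      | e => exact E_mul_mem_S
      | f => exact F_mul_mem_S
      | k =>
        have h := zpow_mul_mem_S 1
        rw [zpow_one] at h
        exact h
      | k' =>
        have h := zpow_mul_mem_S (-1)
        rw [zpow_neg_one] at h
        exact h
      | l => exact L_mul_mem_S
    | mul a b ha hb =>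
      intro x hx
      rw [map_mul, mul_assoc]
      exact ha _ (hb x hx)
    | add a b ha hb =>
      intro x hx
      rw [map_add, add_mul]
      exact add_mem (ha x hx) (hb x hx)
  have h1 : (1 : MU2) ∈ S := by simpa using FE_mem 0 0 0
  refine eq_top_iff.mpr fun x _ => ?_
  obtain ⟨a, rfl⟩ := RingQuot.mkAlgHom_surjective K Rel x
  simpa using hmul a 1 h1

/-! ### Linear independence -/

lemma linearIndependent_of_rank {k ι V : Type*} [Field k] [AddCommGroup V] [Module k V]
    {b : ι → V} (ρ : ι → ℕ)
    (h : ∀ x, ∃ Λ : V →ₗ[k] k, Λ (b x) ≠ 0 ∧ ∀ y, y ≠ x → ρ x ≤ ρ y → Λ (b y) = 0) :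
    LinearIndependent k b := by
  rw [linearIndependent_iff]
  intro l hl
  have key (n : ℕ) : ∀ x, ρ x = n → l x = 0 := by
    induction n using Nat.strong_induction_on with
    | _ n ih =>
      intro x hx
      obtain ⟨Λ, hΛ, hΛ0⟩ := h x
      have h1 := congrArg Λ hl
      rw [Finsupp.linearCombination_apply, Finsupp.sum, map_sum, map_zero,
        Finset.sum_eq_single x] at h1
      · simpa [hΛ] using h1
      · intro y _ hyx
        rcases lt_or_ge (ρ y) (ρ x) with hlt | hge
        · simp [ih _ (hx ▸ hlt) y rfl]
        · simp [hΛ0 y hyx hge]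
      · intro hx0
        simp [Finsupp.notMem_support_iff.mp hx0]
  ext x
  exact key _ x rfl

/-! #### The universal Verma module -/

open LaurentPolynomial

/-- The coefficients of `F` on the universal Verma module. -/
def vermaCoeff : ℕ → K[T;T⁻¹]
  | 0 => 0
  | n + 1 => vermaCoeff n +
      (vv - vv⁻¹)⁻¹ • (vv ^ (-2 * (n : ℤ)) • T 1 - vv ^ (2 * (n : ℤ)) • T (-1))

lemma geom_succ' (n : ℕ) : geom (n + 1) = geom n + vv ^ (-2 * (n : ℤ)) := by
  induction n with
  | zero => simp [geom]
  | succ n ih =>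
    rw [geom, ih, mul_add, ← add_assoc, ← zpow_add₀ vv_ne_zero, ← geom, ih]
    congr 3
    push_cast
    ring

lemma coeff_vermaCoeff (n : ℕ) : (vermaCoeff n).coeff 1 = (vv - vv⁻¹)⁻¹ * geom n := by
  induction n with
  | zero => simp [vermaCoeff, geom]
  | succ n ih =>
    rw [vermaCoeff, geom_succ', mul_add, ← ih]
    simp

lemma vermaCoeff_succ_ne_zero (n : ℕ) : vermaCoeff (n + 1) ≠ 0 := by
  intro h
  have h1 := coeff_vermaCoeff (n + 1)
  rw [h, eq_comm] at h1
  simp [geom_succ_ne_zero, vv_sub_inv_ne_zero] at h1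

/-- The raising operator of the universal Verma module. -/
def vermaE : Module.End K[T;T⁻¹] (ℕ → K[T;T⁻¹]) where
  toFun φ n := φ (n + 1)
  map_add' _ _ := rfl
  map_smul' _ _ := rfl

/-- The lowering operator of the universal Verma module. -/
def vermaF : Module.End K[T;T⁻¹] (ℕ → K[T;T⁻¹]) where
  toFun φ n := vermaCoeff n * φ (n - 1)
  map_add' _ _ := by ext1; simp [mul_add]
  map_smul' _ _ := by ext1; simp [mul_left_comm]

/-- The weight operators of the universal Verma module. -/
def vermaK (t : ℤ) : Module.End K[T;T⁻¹] (ℕ → K[T;T⁻¹]) where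
  toFun φ n := (vv ^ (-2 * ((n : ℤ) * t)) • T t) * φ n
  map_add' _ _ := by ext1; simp [mul_add]
  map_smul' _ _ := by ext1; simp [mul_left_comm]

lemma vermaK_mul (t u : ℤ) : vermaK t * vermaK u = vermaK (t + u) := by
  ext1 φ
  ext1 n
  simp only [vermaK, Module.End.mul_apply, LinearMap.coe_mk, AddHom.coe_mk, T_add, mul_add,
    zpow_add₀ vv_ne_zero, smul_mul_smul_comm, ← mul_assoc]

lemma vermaK_zero : vermaK 0 = 1 := by
  ext1 φ
  ext1 n
  simp [vermaK]

/-- The operator `k` of the universal Verma module. -/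
def vermaUnit : (Module.End K[T;T⁻¹] (ℕ → K[T;T⁻¹]))ˣ where
  val := vermaK 1
  inv := vermaK (-1)
  val_inv := by rw [vermaK_mul]; exact vermaK_zero
  inv_val := by rw [vermaK_mul]; exact vermaK_zero

lemma vermaUnit_zpow (t : ℤ) :
    ((vermaUnit ^ t : (Module.End K[T;T⁻¹] (ℕ → K[T;T⁻¹]))ˣ) : Module.End _ _) = vermaK t := by
  induction t with
  | zero => simp [vermaK_zero]
  | succ n ih => rw [zpow_add_one, Units.val_mul, ih, ← vermaK_mul]; rfl
  | pred n ih => rw [zpow_sub_one, Units.val_mul, ih, sub_eq_add_neg, ← vermaK_mul]; rfl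

lemma verma_qTriple : QTriple vermaE vermaF vermaUnit where
  kE := by
    ext1 φ
    ext1 n
    simp only [vermaE, vermaUnit, vermaK, Module.End.mul_apply, LinearMap.smul_apply,
      LinearMap.coe_mk, AddHom.coe_mk, Pi.smul_apply, ← smul_mul_assoc, smul_smul,
      ← zpow_add₀ vv_ne_zero]
    congr 3
    push_cast
    ring
  kF := by
    ext1 φ
    ext1 n
    rcases n with _ | n
    · simp [vermaF, vermaUnit, vermaK, vermaCoeff]
    · simp only [vermaF, vermaUnit, vermaK, Module.End.mul_apply, LinearMap.smul_apply,
        LinearMap.coe_mk, AddHom.coe_mk, Pi.smul_apply, add_tsub_cancel_right]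
      rw [show -2 * (((n + 1 : ℕ) : ℤ) * 1) = -2 + -2 * ((n : ℤ) * 1) by push_cast; ring,
        zpow_add₀ vv_ne_zero, mul_smul, smul_mul_assoc, mul_left_comm]
  comm := by
    ext1 φ
    ext1 n
    rcases n with _ | n
    · simp [vermaE, vermaF, vermaUnit, vermaK, vermaCoeff]
      ring_nf
    · simp [vermaE, vermaF, vermaUnit, vermaK, vermaCoeff, add_mul, sub_mul, smul_sub]

lemma vermaE_single_succ (n : ℕ) (a : K[T;T⁻¹]) :
    vermaE (Pi.single (n + 1) a) = Pi.single n a := by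
  ext1 m
  simp [vermaE, Pi.single_apply]

lemma vermaE_single_zero (a : K[T;T⁻¹]) : vermaE (Pi.single 0 a) = 0 := by
  ext1 m
  simp [vermaE]

lemma vermaF_single (n : ℕ) (a : K[T;T⁻¹]) :
    vermaF (Pi.single n a) = Pi.single (n + 1) (vermaCoeff (n + 1) * a) := by
  ext1 m
  rcases m with _ | m
  · simp [vermaF, vermaCoeff, Pi.single_apply]
  · by_cases h : m = n
    · subst h; simp [vermaF]
    · simp [vermaF, h]

lemma vermaK_single (t : ℤ) (n : ℕ) (a : K[T;T⁻¹]) :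
    vermaK t (Pi.single n a) = Pi.single n ((vv ^ (-2 * ((n : ℤ) * t)) • T t) * a) := by
  ext1 m
  by_cases h : m = n
  · subst h; simp [vermaK]
  · simp [vermaK, h]

lemma vermaE_pow_single (s : ℕ) (a : K[T;T⁻¹]) :
    (vermaE ^ s) (Pi.single s a) = Pi.single 0 a := by
  induction s with
  | zero => simp
  | succ s ih => rw [pow_succ, Module.End.mul_apply, vermaE_single_succ, ih]

lemma vermaE_pow_single_of_lt {n s : ℕ} (h : n < s) (a : K[T;T⁻¹]) :
    (vermaE ^ s) (Pi.single n a) = 0 := by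
  obtain ⟨m, rfl⟩ := Nat.exists_eq_add_of_lt h
  rw [show n + m + 1 = m + 1 + n by ring, pow_add, Module.End.mul_apply, vermaE_pow_single,
    pow_succ, Module.End.mul_apply, vermaE_single_zero, map_zero]

lemma vermaF_pow_single (r : ℕ) (a : K[T;T⁻¹]) :
    (vermaF ^ r) (Pi.single 0 a) =
      Pi.single r ((∏ i ∈ Finset.range r, vermaCoeff (i + 1)) * a) := by
  induction r with
  | zero => simp
  | succ r ih =>
    rw [pow_succ', Module.End.mul_apply, ih, vermaF_single, Finset.prod_range_succ]
    congr 1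
    ring

lemma exists_leftInverse_mul {q : K[T;T⁻¹]} (hq : q ≠ 0) :
    ∃ Λ : K[T;T⁻¹] →ₗ[K] K[T;T⁻¹], ∀ x, Λ (q * x) = x := by
  obtain ⟨Λ, hΛ⟩ := LinearMap.exists_leftInverse_of_injective (LinearMap.mulLeft K q)
    (LinearMap.ker_eq_bot.mpr (mul_right_injective₀ hq))
  exact ⟨Λ, fun x => LinearMap.congr_fun hΛ x⟩

lemma linearIndependent_verma : LinearIndependent K fun x : ℕ × ℕ × ℤ =>
    vermaF ^ x.1 * vermaE ^ x.2.1 *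
      ((vermaUnit ^ x.2.2 : (Module.End K[T;T⁻¹] (ℕ → K[T;T⁻¹]))ˣ) : Module.End _ _) := by
  refine linearIndependent_of_rank (fun x => x.2.1) ?_
  rintro ⟨r, s, t⟩
  obtain ⟨Λ, hΛ⟩ := exists_leftInverse_mul
    (Finset.prod_ne_zero_iff.mpr fun i (_ : i ∈ Finset.range r) => vermaCoeff_succ_ne_zero i)
  refine ⟨{ toFun := fun X => (Λ (X (Pi.single s 1) r)).coeff t
            map_add' := by simp
            map_smul' := by simp }, ?_, ?_⟩
  · simp [vermaUnit_zpow, vermaK_single, vermaE_pow_single, vermaF_pow_single, hΛ,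
      vv_ne_zero, zpow_ne_zero]
  · rintro ⟨r', s', t'⟩ hne hle
    rcases (show s ≤ s' from hle).lt_or_eq with hlt | rfl
    · simp [vermaUnit_zpow, vermaK_single, vermaE_pow_single_of_lt hlt]
    · by_cases hr : r = r'
      · subst hr
        have ht : t' ≠ t := fun h => hne (by rw [h])
        simp [vermaUnit_zpow, vermaK_single, vermaE_pow_single, vermaF_pow_single, hΛ, ht]
      · simp [vermaUnit_zpow, vermaK_single, vermaE_pow_single, vermaF_pow_single, hr]

/-- In some quantum `sl₂` triple the PBW monomials have coordinate functionals. -/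
lemma exists_qTriple_coordinates : ∃ (A : Type) (_ : Ring A) (_ : Algebra K A) (E F : A) (k : Aˣ)
    (g : A →ₗ[K] (ℕ × ℕ × ℤ →₀ K)), QTriple E F k ∧
      ∀ r s t, g (F ^ r * (E ^ s * ((k ^ t : Aˣ) : A))) = Finsupp.single (r, s, t) 1 := by
  obtain ⟨g, hg⟩ := LinearMap.exists_leftInverse_of_injective _
    (LinearMap.ker_eq_bot.mpr linearIndependent_verma)
  refine ⟨_, _, _, _, _, _, g, verma_qTriple, fun r s t => ?_⟩
  simpa [mul_assoc] using LinearMap.congr_fun hg (Finsupp.single (r, s, t) 1)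

/-! #### Representations of `MU_v(2)` -/

namespace IsMirabolic

variable {A : Type*} [Ring A] [Algebra K A] {E F L : A} {k : Aˣ}

/-- The images of the generators under `IsMirabolic.lift`. -/
def genImage (E F : A) (k : Aˣ) (L : A) : G5 → A
  | G5.e => E
  | G5.f => F
  | G5.k => k
  | G5.k' => (k⁻¹ : Aˣ)
  | G5.l => L

/-- The universal property of `MU_v(2)`. -/
def lift (h : IsMirabolic E F k L) : MU2 →ₐ[K] A :=
  RingQuot.liftAlgHom K ⟨FreeAlgebra.lift K (genImage E F k L), by
    intro x y hxy
    cases hxy with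
    | kk' => simp [genImage]
    | k'k => simp [genImage]
    | kek' => simp [genImage, h.kE]
    | kfk' => simp [genImage, h.kF]
    | effe => simp [genImage, h.comm]
    | ll => simp [genImage, h.ll]
    | kl => simp [genImage, h.kl]
    | lel => simp [genImage, h.lel]
    | lfl => simp [genImage, h.lfl]
    | serreE => simpa [genImage] using h.serreE
    | serreF => simpa [genImage] using h.serreF⟩

@[simp] lemma lift_Ee (h : IsMirabolic E F k L) : h.lift Ee = E := by
  simp [lift, Ee, RingQuot.liftAlgHom_mkAlgHom_apply, genImage]

@[simp] lemma lift_Ff (h : IsMirabolic E F k L) : h.lift Ff = F := by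
  simp [lift, Ff, RingQuot.liftAlgHom_mkAlgHom_apply, genImage]

@[simp] lemma lift_Ll (h : IsMirabolic E F k L) : h.lift Ll = L := by
  simp [lift, Ll, RingQuot.liftAlgHom_mkAlgHom_apply, genImage]

@[simp] lemma lift_kzpow (h : IsMirabolic E F k L) (t : ℤ) :
    h.lift (kzpow t) = ((k ^ t : Aˣ) : A) := by
  have hk : Units.map (h.lift : MU2 →* A) kUnit = k := by
    ext1
    simp [lift, kUnit, Kk, RingQuot.liftAlgHom_mkAlgHom_apply, genImage]
  rw [kzpow_eq, ← congrArg (fun u : Aˣ => ((u ^ t : Aˣ) : A)) hk, ← map_zpow]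
  rfl

end IsMirabolic

namespace QTriple

variable {A : Type*} [Ring A] [Algebra K A] {E F : A} {k : Aˣ}

lemma isMirabolic_zero (h : QTriple E F k) : IsMirabolic E F k 0 where
  __ := h
  ll := by simp
  kl := by simp
  lel := by simp
  lfl := by simp
  serreE := by simp
  serreF := by simp

lemma isMirabolic_one (h : QTriple E F k) : IsMirabolic E F k 1 where
  __ := h
  ll := by simp
  kl := by simp
  lel := by simp
  lfl := by simp
  serreE := by rw [mul_one, mul_one, one_mul, ← add_smul, add_comm]
  serreF := by rw [mul_one, mul_one, one_mul, ← add_smul, add_comm]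

/-- The matrix of `k` in the tensor product of a representation with a two-dimensional one. -/
def matUnit (k : Aˣ) : (Matrix (Fin 2) (Fin 2) A)ˣ where
  val := !![vv • (k : A), 0; 0, vv⁻¹ • (k : A)]
  inv := !![vv⁻¹ • ((k⁻¹ : Aˣ) : A), 0; 0, vv • ((k⁻¹ : Aˣ) : A)]
  val_inv := by simp [Matrix.one_fin_two, vv_ne_zero]
  inv_val := by simp [Matrix.one_fin_two, vv_ne_zero]

lemma matUnit_zpow (k : Aˣ) (t : ℤ) :
    ((matUnit k ^ t : (Matrix (Fin 2) (Fin 2) A)ˣ) : Matrix (Fin 2) (Fin 2) A) =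
      !![vv ^ t • ((k ^ t : Aˣ) : A), 0; 0, vv ^ (-t) • ((k ^ t : Aˣ) : A)] := by
  have h0 := vv_ne_zero
  induction t with
  | zero => simp [Matrix.one_fin_two]
  | succ n ih =>
    rw [zpow_add_one, Units.val_mul, ih]
    simp [matUnit, smul_smul, zpow_add_one, zpow_add₀ h0, mul_comm]
  | pred n ih =>
    rw [zpow_sub_one, Units.val_mul, ih]
    simp [matUnit, smul_smul, zpow_sub_one, zpow_sub₀ h0, zpow_add₀ h0, div_eq_mul_inv,
      mul_comm]

/-- The matrix of `E`. -/
def matE (E : A) (k : Aˣ) : Matrix (Fin 2) (Fin 2) A := !![E, ((k⁻¹ : Aˣ) : A); 0, E]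

/-- The matrix of `F`. -/
def matF (F : A) : Matrix (Fin 2) (Fin 2) A := !![vv • F, 0; 1, vv⁻¹ • F]

/-- The matrix of `ℓ`. -/
def matL : Matrix (Fin 2) (Fin 2) A := !![0, 0; 0, 1]

lemma cons_zero_zero_fin_two {B : Type*} [Zero B] : (![0, 0] : Fin 2 → B) = 0 := by
  ext i
  fin_cases i <;> rfl

lemma isMirabolic_mat (h : QTriple E F k) :
    IsMirabolic (matE E k) (matF F) (matUnit k) matL where
  kE := by
    have h0 := vv_ne_zero
    simp [matE, matUnit, Matrix.smul_of, h.kE, smul_smul, mul_comm]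
    congr 1
    field_simp
  kF := by
    have h0 := vv_ne_zero
    simp [matF, matUnit, Matrix.smul_of, h.kF, smul_smul, mul_comm]
    refine ⟨?_, ?_, ?_⟩ <;> congr 1 <;> field_simp
  comm := by
    have h0 := vv_ne_zero
    simp [matE, matF, matUnit, Matrix.smul_of, h.comm, smul_smul]
    have hκ := inv_mul_cancel₀ vv_sub_inv_ne_zero
    rw [h.inv_mul_F]
    generalize (vv - vv⁻¹)⁻¹ = κ at hκ ⊢
    simp only [smul_sub, smul_smul]
    refine ⟨⟨?_, ?_⟩, ?_⟩
    · rw [add_assoc, mul_comm vv κ, show κ * vv⁻¹ = κ * vv - 1 by linear_combination -hκ, sub_smul,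
        one_smul]
      abel
    · congr 1
      rw [zpow_two, inv_mul_cancel_left₀ h0]
    · rw [mul_comm vv⁻¹ κ, show κ * vv⁻¹ = κ * vv - 1 by linear_combination -hκ, sub_smul,
        sub_smul, one_smul, one_smul]
      abel
  ll := by simp [matL, cons_zero_zero_fin_two]
  kl := by simp [matL, matUnit]
  lel := by simp [matL, matE]
  lfl := by simp [matL, matF, cons_zero_zero_fin_two]
  serreE := by
    have h1 := h.inv_mul_E
    have h0 := vv_ne_zero
    simp [matE, matL, Matrix.smul_of, h1]
    simp only [smul_smul, ← add_smul]
    refine ⟨?_, ?_⟩ <;> congr 1 <;> field_simp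
    rw [add_comm]
  serreF := by
    have h0 := vv_ne_zero
    simp [matF, matL, Matrix.smul_of, cons_zero_zero_fin_two]
    simp only [smul_smul, ← add_smul]
    refine ⟨?_, ?_⟩ <;> congr 1 <;> field_simp
    rw [add_comm]

lemma matE_pow (h : QTriple E F k) (s : ℕ) :
    matE E k ^ s = !![E ^ s, geom s • (E ^ (s - 1) * ((k⁻¹ : Aˣ) : A)); 0, E ^ s] := by
  induction s with
  | zero => simp [Matrix.one_fin_two, geom]
  | succ s ih =>
    rw [pow_succ', ih]
    have hk := h.zpow_mul_E_pow (-1) s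
    rw [zpow_neg_one] at hk
    rcases s with _ | s
    · simp [matE, geom]
    · rw [show 2 * (-1 * ((s + 1 : ℕ) : ℤ)) = -2 * ((s + 1 : ℕ) : ℤ) by ring] at hk
      rw [geom_succ' (s + 1), add_smul, Nat.add_sub_cancel (s + 1), ← hk]
      simp [matE, pow_succ', mul_assoc]

lemma matF_pow (F : A) (r : ℕ) :
    matF F ^ r = !![vv ^ r • F ^ r, 0; qint r • F ^ (r - 1), vv ^ (-(r : ℤ)) • F ^ r] := by
  induction r with
  | zero => simp [Matrix.one_fin_two, qint]
  | succ r ih =>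
    have h0 := vv_ne_zero
    have hr := qint_mul r
    rw [pow_succ', ih]
    rcases r with _ | r
    · simp [matF, qint]
    · have hq : qint (r + 1 + 1) = vv * vv ^ r + vv⁻¹ * qint (r + 1) := by
        rw [zpow_natCast, pow_succ'] at hr
        rw [qint]
        linear_combination hr
      simp [matF, pow_succ', smul_smul, ← add_smul, zpow_add₀ h0, hq]

end QTriple

/-! #### Coordinate functionals of the PBW monomials -/

/-- The order in which the coefficients of a relation between PBW monomials are eliminated. -/
def pbwRank (p : Fin 6 × ℕ × ℕ × ℤ) : ℕ :=
  if p.1 = 0 then 0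
  else if p.1 = 5 then 1
  else if p.1 = 1 then (if p.2.1 = 0 then 3 else 2)
  else if p.1 = 2 then (if p.2.2.1 = 0 then 3 else 2)
  else if p.1 = 3 then 4
  else 5

/-- `Λ` detects the PBW monomial with index `x` among those of at least the same rank. -/
def Detects (Λ : MU2 →ₗ[K] K) (x : {p : Fin 6 × ℕ × ℕ × ℤ // pbwOK p}) : Prop :=
  Λ (pbw x) ≠ 0 ∧ ∀ y, y ≠ x → pbwRank x.1 ≤ pbwRank y.1 → Λ (pbw y) = 0

section Detects

lemma inv_mul_zpow {A : Type*} [Ring A] (k : Aˣ) (t : ℤ) :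
    ((k⁻¹ : Aˣ) : A) * ((k ^ t : Aˣ) : A) = ((k ^ (t - 1) : Aˣ) : A) := by
  rw [← Units.val_mul, ← zpow_neg_one, ← zpow_add, neg_add_eq_sub]
variable {A : Type*} [Ring A] [Algebra K A] {E F : A} {k : Aˣ}

/-- A matrix entry of the two-dimensional representation. -/
def entry (h : QTriple E F k) (i j : Fin 2) : MU2 →ₗ[K] A :=
  Matrix.entryLinearMap K A i j ∘ₗ h.isMirabolic_mat.lift.toLinearMap

/-- The coefficient of `F ^ r * E ^ s * k ^ t` given by a coordinate map `g`. -/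
def coord (g : A →ₗ[K] (ℕ × ℕ × ℤ →₀ K)) (r s : ℕ) (t : ℤ) : A →ₗ[K] K :=
  Finsupp.lapply (r, s, t) ∘ₗ g

/-- `g` is a coordinate map for the monomials `F ^ r * E ^ s * k ^ t`. -/
def IsCoord (E F : A) (k : Aˣ) (g : A →ₗ[K] (ℕ × ℕ × ℤ →₀ K)) : Prop :=
  ∀ r s t, g (F ^ r * (E ^ s * ((k ^ t : Aˣ) : A))) = Finsupp.single (r, s, t) 1

variable {g : A →ₗ[K] (ℕ × ℕ × ℤ →₀ K)} {r s : ℕ} {t : ℤ}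

lemma detects_zero (h : QTriple E F k) (hg : IsCoord E F k g) (hx : pbwOK (0, r, s, t)) :
    Detects (coord g r s t ∘ₗ h.isMirabolic_zero.lift.toLinearMap) ⟨(0, r, s, t), hx⟩ := by
  refine ⟨by simp [coord, pbw, mul_assoc, hg r s t], ?_⟩
  rintro ⟨⟨j, r', s', t'⟩, hy⟩ hne -
  fin_cases j <;> simp [coord, pbw, mul_assoc, hg r' s' t']
  simpa [Finsupp.single_apply] using hne

lemma detects_one_left (h : QTriple E F k) (hg : IsCoord E F k g) (hx : pbwOK (1, 0, s, t)) :
    Detects (coord g 0 s t ∘ₗ h.isMirabolic_one.lift.toLinearMap) ⟨(1, 0, s, t), hx⟩ := by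
  constructor
  · have hgE := hg 0 s t
    rw [pow_zero, one_mul] at hgE
    simp [coord, pbw, mul_assoc, hgE]
  rintro ⟨⟨j, r', s', t'⟩, hy⟩ hne hle
  fin_cases j <;> simp [pbwRank] at hle <;>
    simp [coord, pbw, mul_assoc, hg r' s' t', Finsupp.single_apply] <;> simp [pbwOK] at hy hne <;>
    grind

lemma detects_one (h : QTriple E F k) (hg : IsCoord E F k g) (hx : pbwOK (1, r + 1, s, t)) :
    Detects (coord g r s t ∘ₗ entry h 1 0) ⟨(1, r + 1, s, t), hx⟩ := by
  constructor
  · simp [coord, entry, pbw, mul_assoc, hg _ _ _, h.matE_pow, QTriple.matF_pow,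
      QTriple.matUnit_zpow, QTriple.matL, qint_succ_ne_zero,
      zpow_ne_zero _ vv_ne_zero]
  rintro ⟨⟨j, r', s', t'⟩, hy⟩ hne hle
  fin_cases j <;> simp [pbwRank] at hle <;>
    simp [coord, entry, pbw, mul_assoc, hg _ _ _, h.matE_pow, QTriple.matF_pow,
      QTriple.matUnit_zpow, QTriple.matL, Finsupp.single_apply] <;> simp [pbwOK] at hy hne
  grind [qint]

lemma detects_two_left (h : QTriple E F k) (hg : IsCoord E F k g) (hx : pbwOK (2, r, 0, t)) :
    Detects (coord g r 0 t ∘ₗ h.isMirabolic_one.lift.toLinearMap) ⟨(2, r, 0, t), hx⟩ := by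
  constructor
  · have hgF := hg r 0 t
    rw [pow_zero, one_mul] at hgF
    simp [coord, pbw, hgF]
  rintro ⟨⟨j, r', s', t'⟩, hy⟩ hne hle
  fin_cases j <;> simp [pbwRank] at hle <;>
    simp [coord, pbw, mul_assoc, hg r' s' t', Finsupp.single_apply] <;>
    simp [pbwOK] at hx hy hne <;> grind

lemma detects_two (h : QTriple E F k) (hg : IsCoord E F k g) (hx : pbwOK (2, r, s + 1, t)) :
    Detects (coord g r s (t - 1) ∘ₗ entry h 0 1) ⟨(2, r, s + 1, t), hx⟩ := by
  constructor
  · simp [coord, entry, pbw, mul_assoc, hg _ _ _, h.matE_pow, QTriple.matF_pow,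
      QTriple.matUnit_zpow, QTriple.matL, geom_succ_ne_zero, vv_ne_zero,
      zpow_ne_zero _ vv_ne_zero, inv_mul_zpow]
  rintro ⟨⟨j, r', s', t'⟩, hy⟩ hne hle
  fin_cases j <;> simp [pbwRank] at hle <;>
    simp [coord, entry, pbw, mul_assoc, hg _ _ _, h.matE_pow, QTriple.matF_pow, inv_mul_zpow,
      QTriple.matUnit_zpow, QTriple.matL, Finsupp.single_apply] <;> simp [pbwOK] at hy hne
  grind [geom]

lemma detects_three (h : QTriple E F k) (hg : IsCoord E F k g)
    (hx : pbwOK (3, r + 1, s + 1, t)) :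
    Detects (coord g r s (t - 1) ∘ₗ
      (entry h 1 1 - vv ^ (-(r : ℤ) - (t - 1)) • h.isMirabolic_one.lift.toLinearMap))
      ⟨(3, r + 1, s + 1, t), hx⟩ := by
  constructor
  · simp [coord, entry, pbw, mul_assoc, hg _ _ _, h.matE_pow, QTriple.matF_pow, inv_mul_zpow,
      QTriple.matUnit_zpow, QTriple.matL, zpow_ne_zero _ vv_ne_zero, qint_succ_ne_zero,
      geom_succ_ne_zero]
  have hv : vv ^ (-(r : ℤ) - (t - 1)) = (vv ^ r)⁻¹ * (vv ^ (t - 1))⁻¹ := by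
    rw [zpow_sub₀ vv_ne_zero, zpow_neg, zpow_natCast, div_eq_mul_inv]
  rintro ⟨⟨j, r', s', t'⟩, hy⟩ hne hle
  fin_cases j <;> simp [pbwRank] at hle <;>
    simp [coord, entry, pbw, mul_assoc, hg _ _ _, h.matE_pow, QTriple.matF_pow, inv_mul_zpow,
      QTriple.matUnit_zpow, QTriple.matL, Finsupp.single_apply] <;> simp [pbwOK] at hy hne
  all_goals
    rw [hv]
    grind

lemma detects_four (h : QTriple E F k) (hg : IsCoord E F k g) (hx : pbwOK (4, r, s, t)) :
    Detects (coord g r s t ∘ₗ h.isMirabolic_one.lift.toLinearMap) ⟨(4, r, s, t), hx⟩ := by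
  refine ⟨by simp [coord, pbw, mul_assoc, hg r s t], ?_⟩
  rintro ⟨⟨j, r', s', t'⟩, hy⟩ hne hle
  fin_cases j <;> simp [pbwRank] at hle
  · split at hle <;> omega
  · split at hle <;> omega
  simp [coord, pbw, mul_assoc, hg r' s' t']
  simpa [Finsupp.single_apply] using hne

lemma detects_five (h : QTriple E F k) (hg : IsCoord E F k g)
    (hx : pbwOK (5, r + 1, s + 1, t)) :
    Detects (coord g s r (1 - t) ∘ₗ entry h.swap 0 0) ⟨(5, r + 1, s + 1, t), hx⟩ := by
  have hk (r : ℕ) (t : ℤ) : (k : A) * (E ^ r * (((k ^ t)⁻¹ : Aˣ) : A)) =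
      vv ^ (2 * (r : ℤ)) • (E ^ r * ((k ^ (1 - t) : Aˣ) : A)) := by
    have hE := h.zpow_mul_E_pow 1 r
    rw [zpow_one, one_mul] at hE
    rw [← mul_assoc, hE, smul_mul_assoc, mul_assoc, ← Units.val_mul, zpow_sub, zpow_one]
  constructor
  · simp [coord, entry, pbw, mul_assoc, hg _ _ _, h.swap.matE_pow, QTriple.matF_pow, hk,
      QTriple.matUnit_zpow, QTriple.matL, geom_succ_ne_zero, qint_succ_ne_zero,
      zpow_ne_zero _ vv_ne_zero]
  rintro ⟨⟨j, r', s', t'⟩, hy⟩ hne hle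
  fin_cases j <;> simp [pbwRank] at hle <;>
    simp [coord, entry, pbw, mul_assoc, hg _ _ _, h.swap.matE_pow, QTriple.matF_pow, hk,
      QTriple.matUnit_zpow, QTriple.matL, Finsupp.single_apply]
  simp [pbwOK] at hy hne
  grind

end Detects

lemma linearIndependent_pbw : LinearIndependent K pbw := by
  obtain ⟨A, _, _, E, F, k, g, h, hg⟩ := exists_qTriple_coordinates
  refine linearIndependent_of_rank (fun x => pbwRank x.1) ?_
  rintro ⟨⟨i, r, s, t⟩, hx⟩
  fin_cases i
  · exact ⟨_, detects_zero h hg hx⟩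
  · rcases r with _ | r
    · exact ⟨_, detects_one_left h hg hx⟩
    · exact ⟨_, detects_one h hg hx⟩
  · rcases s with _ | s
    · exact ⟨_, detects_two_left h hg hx⟩
    · exact ⟨_, detects_two h hg hx⟩
  · obtain ⟨r, rfl⟩ := Nat.exists_eq_add_of_le' hx.1
    obtain ⟨s, rfl⟩ := Nat.exists_eq_add_of_le' hx.2
    exact ⟨_, detects_three h hg hx⟩
  · exact ⟨_, detects_four h hg hx⟩
  · obtain ⟨r, rfl⟩ := Nat.exists_eq_add_of_le' hx.1
    obtain ⟨s, rfl⟩ := Nat.exists_eq_add_of_le' hx.2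
    exact ⟨_, detects_five h hg hx⟩

/-- Theorem 4.8: the PBW monomials are linearly independent over `K`, hence form a
basis of `MU_v(2)` (they span by Proposition 4.5). -/
theorem pbw_basis :
    LinearIndependent K pbw ∧ Submodule.span K (Set.range pbw) = ⊤ := by
  exact ⟨linearIndependent_pbw, span_pbw_eq_top⟩

end

end MirabolicSL2
end

section
/- For each n ∈ ℕ₊ and each sign choice ±, the formulas k·m_{i,ε} = ±v^{n−2i}m_{i,ε}, ℓ·m_{i,ε} = ε·m_{i,ε}, f·m_{i,0} = m_{i+1,0} + (v^i/[i+1])m_{i+1,1}, f·m_{i,1} = v^{−1}([i]/[i+1])m_{i+1,1}, e·m_{i,0} = ±v[i][n−i]m_{i−1,0}, e·m_{i,1} = ±[i][n+1−i]m_{i−1,1} ± v^{i−n}[i]m_{i−1,0} (with m_{i,ε} interpreted as 0 for indices outside the allowed ranges) define a left MU_v(2)-module structure on the 2n-dimensional K-vector space L^±(n,01) with basis {m_{i,0} : 0 ≤ i ≤ n−1} ∪ {m_{j,1} : 1 ≤ j ≤ n}; that is, the operators so defined satisfy all the defining relations of MU_v(2). -/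
set_option synthInstance.maxHeartbeats 1000000
set_option maxHeartbeats 1000000

namespace MirabolicSL2

noncomputable section

/-- The sign `±1`. -/
def sgn (pos : Bool) : K := if pos then 1 else -1

/-- The index type for the basis of `L^±(n,01)`: `Sum.inl i` is the basis vector
`m_{i,0}` (`0 ≤ i ≤ n-1`) and `Sum.inr j` is the basis vector `m_{j+1,1}`
(so that the second index ranges over `1 ≤ j+1 ≤ n`). -/
abbrev I01 (n : ℕ) : Type := Fin n ⊕ Fin n

/-- The matrix of the action of `k` on `L^±(n,01)`: `k·m_{i,ε} = ±v^{n-2i} m_{i,ε}`. -/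
def kMat01 (pos : Bool) (n : ℕ) : Matrix (I01 n) (I01 n) K := fun b b' =>
  if b = b' then
    (match b with
      | Sum.inl i => sgn pos * vv ^ ((n : ℤ) - 2 * ((i : ℕ) : ℤ))
      | Sum.inr j => sgn pos * vv ^ ((n : ℤ) - 2 * (((j : ℕ) : ℤ) + 1)))
  else 0

/-- The matrix of the action of `ℓ` on `L^±(n,01)`: `ℓ·m_{i,ε} = ε m_{i,ε}`. -/
def lMat01 (n : ℕ) : Matrix (I01 n) (I01 n) K := fun b b' =>
  if b = b' then (match b with | Sum.inl _ => 0 | Sum.inr _ => 1) else 0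

/-- The matrix of the action of `f` on `L^±(n,01)`:
`f·m_{i,0} = m_{i+1,0} + (v^i/[i+1]) m_{i+1,1}`, `f·m_{i,1} = v⁻¹([i]/[i+1]) m_{i+1,1}`. -/
def fMat01 (n : ℕ) : Matrix (I01 n) (I01 n) K := fun b b' =>
  match b, b' with
  | Sum.inl i, Sum.inl i' => if (i : ℕ) = (i' : ℕ) + 1 then 1 else 0
  | Sum.inr j, Sum.inl i' =>
      if (j : ℕ) = (i' : ℕ) then vv ^ ((i' : ℕ) : ℤ) / qn ((i' : ℕ) + 1) else 0
  | Sum.inr j, Sum.inr j' =>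
      if (j : ℕ) = (j' : ℕ) + 1 then vv⁻¹ * qn ((j' : ℕ) + 1) / qn ((j' : ℕ) + 2) else 0
  | Sum.inl _, Sum.inr _ => 0

/-- The matrix of the action of `e` on `L^±(n,01)`:
`e·m_{i,0} = ±v[i][n-i] m_{i-1,0}`,
`e·m_{i,1} = ±[i][n+1-i] m_{i-1,1} ± v^{i-n}[i] m_{i-1,0}`. -/
def eMat01 (pos : Bool) (n : ℕ) : Matrix (I01 n) (I01 n) K := fun b b' =>
  match b, b' with
  | Sum.inl i, Sum.inl i' =>
      if (i : ℕ) + 1 = (i' : ℕ) then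
        sgn pos * vv * qn ((i' : ℕ)) * qn ((n : ℤ) - ((i' : ℕ) : ℤ)) else 0
  | Sum.inl i, Sum.inr j' =>
      if (i : ℕ) = (j' : ℕ) then
        sgn pos * vv ^ ((((j' : ℕ) : ℤ) + 1) - (n : ℤ)) * qn (((j' : ℕ) : ℤ) + 1) else 0
  | Sum.inr j, Sum.inr j' =>
      if (j : ℕ) + 1 = (j' : ℕ) then
        sgn pos * qn (((j' : ℕ) : ℤ) + 1) * qn ((n : ℤ) - ((j' : ℕ) : ℤ)) else 0
  | Sum.inr _, Sum.inl _ => 0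

lemma vv_pow_ne_one {m : ℕ} (hm : m ≠ 0) : vv ^ m ≠ 1 := by
  intro h
  have h1 : (Polynomial.X ^ m : Polynomial ℂ) = 1 := by
    apply RatFunc.algebraMap_injective ℂ
    simpa [vv] using h
  have h2 := congrArg Polynomial.natDegree h1
  simp at h2
  exact hm h2

lemma vv_zpow_sub_ne_zero {m : ℕ} (hm : m ≠ 0) : vv ^ (m : ℤ) - vv ^ (-(m : ℤ)) ≠ 0 := by
  intro h
  apply vv_pow_ne_one (m := 2 * m) (by omega)
  rw [sub_eq_zero, zpow_neg, zpow_natCast] at h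
  rw [two_mul, pow_add]
  nth_rewrite 1 [h]
  exact inv_mul_cancel₀ (pow_ne_zero _ vv_ne_zero)

lemma vv_sq_sub_one_ne_zero : vv ^ 2 - 1 ≠ 0 :=
  sub_ne_zero.mpr (vv_pow_ne_one two_ne_zero)

lemma qn_ne_zero {m : ℕ} (hm : m ≠ 0) : qn m ≠ 0 :=
  div_ne_zero (vv_zpow_sub_ne_zero hm) vv_sub_inv_ne_zero

lemma qn_zero : qn 0 = 0 := by simp [qn]

lemma sgn_mul_self (pos : Bool) : sgn pos * sgn pos = 1 := by
  cases pos <;> simp [sgn]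

/-- `[a + 1][b - 1] - [a][b] = [b - a - 1]`. -/
lemma qn_mul_sub (a b : ℤ) :
    qn (a + 1) * qn (b - 1) - qn a * qn b = qn (b - a - 1) := by
  have hv := vv_ne_zero
  have hd := vv_sub_inv_ne_zero
  have ha := zpow_ne_zero a hv
  have hb := zpow_ne_zero b hv
  have hd' := vv_sq_sub_one_ne_zero
  simp only [qn, neg_add, sub_eq_add_neg, neg_neg, zpow_add₀ hv, zpow_neg, zpow_one]
  simp only [← sub_eq_add_neg]
  field_simp
  ring

/-- `v[m] + v⁻ᵐ = [m + 1]`. -/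
lemma vv_mul_qn_add (m : ℤ) : vv * qn m + vv ^ (-m) = qn (m + 1) := by
  have hv := vv_ne_zero
  have hd := vv_sub_inv_ne_zero
  have ha := zpow_ne_zero m hv
  have hd' := vv_sq_sub_one_ne_zero
  simp only [qn, neg_add, zpow_add₀ hv, zpow_neg, zpow_one]
  field_simp
  ring

/-- `v⁻¹[m] - v⁻ᵐ = [m - 1]`. -/
lemma inv_mul_qn_sub (m : ℤ) : vv⁻¹ * qn m - vv ^ (-m) = qn (m - 1) := by
  have h := vv_mul_qn_add (m - 1)
  have hv := vv_ne_zero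
  rw [sub_add_cancel] at h
  rw [← h, mul_add, inv_mul_cancel_left₀ hv, neg_sub, zpow_sub₀ hv, zpow_neg, zpow_one]
  field_simp
  ring

lemma sum_ite_val_eq {n : ℕ} (m : ℕ) (g x : Fin n → K) :
    ∑ j : Fin n, (if m = (j : ℕ) then g j else 0) * x j =
      if h : m < n then g ⟨m, h⟩ * x ⟨m, h⟩ else 0 := by
  split_ifs with h
  · rw [Finset.sum_eq_single ⟨m, h⟩]
    · simp
    · intro b _ hb
      rw [if_neg (fun h' => hb (Fin.ext h'.symm)), zero_mul]
    · simp
  · refine Finset.sum_eq_zero fun j _ => ?_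
    rw [if_neg (by have := j.2; omega), zero_mul]

lemma sum_ite_val_eq_add_one {n : ℕ} (i : Fin n) (g x : Fin n → K) :
    ∑ j : Fin n, (if (i : ℕ) = (j : ℕ) + 1 then g j else 0) * x j =
      if 0 < (i : ℕ) then g ⟨i - 1, by omega⟩ * x ⟨i - 1, by omega⟩ else 0 := by
  split_ifs with h
  · rw [Finset.sum_eq_single ⟨i - 1, by omega⟩]
    · rw [if_pos (by simp only; omega)]
    · intro b _ hb
      rw [if_neg (fun h' => hb (Fin.ext (by simp only; omega))), zero_mul]
    · simp
  · refine Finset.sum_eq_zero fun j _ => ?_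
    rw [if_neg (by omega), zero_mul]

variable {n : ℕ}

/-- The coordinate of `m_{i,0}`, extended by zero outside its range. -/
def coordZero (x : I01 n → K) (i : ℕ) : K := if h : i < n then x (Sum.inl ⟨i, h⟩) else 0

/-- The coordinate of `m_{i+1,1}`, extended by zero outside its range. -/
def coordOne (x : I01 n → K) (i : ℕ) : K := if h : i < n then x (Sum.inr ⟨i, h⟩) else 0

lemma coordZero_of_le (x : I01 n → K) {i : ℕ} (h : n ≤ i) : coordZero x i = 0 :=
  dif_neg (by omega)

lemma coordOne_of_le (x : I01 n → K) {i : ℕ} (h : n ≤ i) : coordOne x i = 0 :=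
  dif_neg (by omega)

lemma ext_coord {x y : I01 n → K} (h0 : ∀ i < n, coordZero x i = coordZero y i)
    (h1 : ∀ i < n, coordOne x i = coordOne y i) : x = y := by
  funext b
  rcases b with i | i
  · simpa [coordZero] using h0 i i.2
  · simpa [coordOne] using h1 i i.2

lemma coordZero_add (x y : I01 n → K) (i : ℕ) :
    coordZero (x + y) i = coordZero x i + coordZero y i := by
  unfold coordZero; split_ifs <;> simp

lemma coordOne_add (x y : I01 n → K) (i : ℕ) :
    coordOne (x + y) i = coordOne x i + coordOne y i := by
  unfold coordOne; split_ifs <;> simp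

lemma coordZero_sub (x y : I01 n → K) (i : ℕ) :
    coordZero (x - y) i = coordZero x i - coordZero y i := by
  unfold coordZero; split_ifs <;> simp

lemma coordOne_sub (x y : I01 n → K) (i : ℕ) :
    coordOne (x - y) i = coordOne x i - coordOne y i := by
  unfold coordOne; split_ifs <;> simp

lemma coordZero_smul (c : K) (x : I01 n → K) (i : ℕ) :
    coordZero (c • x) i = c * coordZero x i := by
  unfold coordZero; split_ifs <;> simp

lemma coordOne_smul (c : K) (x : I01 n → K) (i : ℕ) :
    coordOne (c • x) i = c * coordOne x i := by
  unfold coordOne; split_ifs <;> simp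

/-- The matrix of the action of `k⁻¹`. -/
def kInvMat01 (pos : Bool) (n : ℕ) : Matrix (I01 n) (I01 n) K :=
  Matrix.diagonal fun b => match b with
    | Sum.inl i => sgn pos * vv ^ (2 * ((i : ℕ) : ℤ) - (n : ℤ))
    | Sum.inr j => sgn pos * vv ^ (2 * (((j : ℕ) : ℤ) + 1) - (n : ℤ))

lemma coordZero_e (pos : Bool) (x : I01 n → K) {i : ℕ} (hi : i < n) :
    coordZero (Matrix.toLin' (eMat01 pos n) x) i =
      sgn pos * vv * qn (i + 1) * qn (n - i - 1) * coordZero x (i + 1) +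
        sgn pos * vv ^ ((i : ℤ) + 1 - n) * qn (i + 1) * coordOne x i := by
  simp only [coordZero, coordOne, hi, dif_pos, Matrix.toLin'_apply, Matrix.mulVec, dotProduct,
    Fintype.sum_sum_type, eMat01]
  rw [sum_ite_val_eq (i + 1) _ fun j => x (Sum.inl j), sum_ite_val_eq i _ fun j => x (Sum.inr j),
    dif_pos hi]
  congr 1
  split_ifs with h
  · push_cast; ring_nf
  · simp

lemma coordOne_e (pos : Bool) (x : I01 n → K) {i : ℕ} (hi : i < n) :
    coordOne (Matrix.toLin' (eMat01 pos n) x) i =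
      sgn pos * qn (i + 2) * qn (n - i - 1) * coordOne x (i + 1) := by
  simp only [coordOne, hi, dif_pos, Matrix.toLin'_apply, Matrix.mulVec, dotProduct,
    Fintype.sum_sum_type, eMat01]
  rw [sum_ite_val_eq (i + 1) _ fun j => x (Sum.inr j)]
  simp only [zero_mul, Finset.sum_const_zero, zero_add]
  split_ifs with h
  · push_cast; ring_nf
  · simp

lemma coordZero_f_zero (x : I01 n → K) : coordZero (Matrix.toLin' (fMat01 n) x) 0 = 0 := by
  unfold coordZero
  split_ifs with hi
  · simp only [Matrix.toLin'_apply, Matrix.mulVec, dotProduct, Fintype.sum_sum_type, fMat01]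
    simp
  · rfl

lemma coordZero_f_succ (x : I01 n → K) {i : ℕ} (hi : i + 1 < n) :
    coordZero (Matrix.toLin' (fMat01 n) x) (i + 1) = coordZero x i := by
  have hi' : i < n := by omega
  simp only [coordZero, hi, hi', dif_pos, Matrix.toLin'_apply, Matrix.mulVec, dotProduct,
    Fintype.sum_sum_type, fMat01]
  rw [sum_ite_val_eq_add_one ⟨i + 1, hi⟩ (fun _ => 1) fun j => x (Sum.inl j)]
  simp

lemma coordOne_f (x : I01 n → K) {i : ℕ} (hi : i < n) :
    coordOne (Matrix.toLin' (fMat01 n) x) i =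
      vv ^ (i : ℤ) / qn (i + 1) * coordZero x i +
        vv⁻¹ * qn i / qn (i + 1) * coordOne x (i - 1) := by
  have hi' : i - 1 < n := by omega
  simp only [coordZero, coordOne, hi, hi', dif_pos, Matrix.toLin'_apply, Matrix.mulVec, dotProduct,
    Fintype.sum_sum_type, fMat01]
  rw [sum_ite_val_eq i _ fun j => x (Sum.inl j),
    sum_ite_val_eq_add_one ⟨i, hi⟩ _ fun j => x (Sum.inr j)]
  rcases i with _ | i
  · simp [hi, qn_zero]
  · simp [hi, add_assoc, one_add_one_eq_two]

/-- At the boundary `i + 1 = n` both sides vanish because `[0] = 0`. -/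
lemma qn_mul_coordZero_f (x : I01 n → K) {i : ℕ} (hi : i < n) :
    qn (n - i - 1) * coordZero (Matrix.toLin' (fMat01 n) x) (i + 1) =
      qn (n - i - 1) * coordZero x i := by
  rcases Nat.lt_or_ge (i + 1) n with h | h
  · rw [coordZero_f_succ x h]
  · rw [show (n : ℤ) - i - 1 = 0 by omega, qn_zero, zero_mul, zero_mul]

/-- At the boundary `i + 1 = n` both sides vanish because `[0] = 0`. -/
lemma qn_mul_coordOne_f (x : I01 n → K) {i : ℕ} (hi : i < n) :
    qn (n - i - 1) * coordOne (Matrix.toLin' (fMat01 n) x) (i + 1) =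
      qn (n - i - 1) * (vv ^ ((i : ℤ) + 1) / qn (i + 2) * coordZero x (i + 1) +
        vv⁻¹ * qn (i + 1) / qn (i + 2) * coordOne x i) := by
  rcases Nat.lt_or_ge (i + 1) n with h | h
  · rw [coordOne_f x h]
    push_cast
    rw [add_assoc, one_add_one_eq_two]
  · rw [show (n : ℤ) - i - 1 = 0 by omega, qn_zero, zero_mul, zero_mul]

lemma coordZero_f_e (pos : Bool) (x : I01 n → K) {i : ℕ} (hi : i < n) :
    coordZero (Matrix.toLin' (fMat01 n) (Matrix.toLin' (eMat01 pos n) x)) i =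
      sgn pos * vv * qn i * qn (n - i) * coordZero x i +
        sgn pos * vv ^ ((i : ℤ) - n) * qn i * coordOne x (i - 1) := by
  rcases i with _ | i
  · rw [coordZero_f_zero]
    simp [qn_zero]
  · rw [coordZero_f_succ _ hi, coordZero_e pos x (by omega)]
    push_cast
    rw [sub_sub]

lemma qn_mul_coordOne_e (pos : Bool) (x : I01 n → K) {i : ℕ} (hi : i < n) :
    qn i * coordOne (Matrix.toLin' (eMat01 pos n) x) (i - 1) =
      qn i * (sgn pos * qn (i + 1) * qn (n - i) * coordOne x i) := by
  rcases i with _ | i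
  · simp [qn_zero]
  · rw [Nat.add_sub_cancel, coordOne_e pos x (by omega)]
    push_cast
    rw [sub_sub, add_assoc, one_add_one_eq_two]

lemma kMat01_eq_diagonal (pos : Bool) (n : ℕ) :
    kMat01 pos n = Matrix.diagonal fun b => match b with
      | Sum.inl i => sgn pos * vv ^ ((n : ℤ) - 2 * ((i : ℕ) : ℤ))
      | Sum.inr j => sgn pos * vv ^ ((n : ℤ) - 2 * (((j : ℕ) : ℤ) + 1)) := rfl

lemma lMat01_eq_diagonal (n : ℕ) :
    lMat01 n = Matrix.diagonal fun b => match b with | Sum.inl _ => 0 | Sum.inr _ => 1 := rfl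

lemma coordZero_k (pos : Bool) (x : I01 n → K) (i : ℕ) :
    coordZero (Matrix.toLin' (kMat01 pos n) x) i =
      sgn pos * vv ^ ((n : ℤ) - 2 * i) * coordZero x i := by
  unfold coordZero
  split_ifs
  · simp [kMat01_eq_diagonal, Matrix.mulVec_diagonal]
  · simp

lemma coordOne_k (pos : Bool) (x : I01 n → K) (i : ℕ) :
    coordOne (Matrix.toLin' (kMat01 pos n) x) i =
      sgn pos * vv ^ ((n : ℤ) - 2 * (i + 1)) * coordOne x i := by
  unfold coordOne
  split_ifs
  · simp [kMat01_eq_diagonal, Matrix.mulVec_diagonal]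
  · simp

lemma coordZero_kInv (pos : Bool) (x : I01 n → K) (i : ℕ) :
    coordZero (Matrix.toLin' (kInvMat01 pos n) x) i =
      sgn pos * vv ^ (2 * (i : ℤ) - n) * coordZero x i := by
  unfold coordZero
  split_ifs
  · simp [kInvMat01, Matrix.mulVec_diagonal]
  · simp

lemma coordOne_kInv (pos : Bool) (x : I01 n → K) (i : ℕ) :
    coordOne (Matrix.toLin' (kInvMat01 pos n) x) i =
      sgn pos * vv ^ (2 * ((i : ℤ) + 1) - n) * coordOne x i := by
  unfold coordOne
  split_ifs
  · simp [kInvMat01, Matrix.mulVec_diagonal]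
  · simp

lemma coordZero_l (x : I01 n → K) (i : ℕ) : coordZero (Matrix.toLin' (lMat01 n) x) i = 0 := by
  unfold coordZero
  split_ifs
  · simp [lMat01_eq_diagonal, Matrix.mulVec_diagonal]
  · simp

lemma coordOne_l (x : I01 n → K) (i : ℕ) :
    coordOne (Matrix.toLin' (lMat01 n) x) i = coordOne x i := by
  unfold coordOne
  split_ifs
  · simp [lMat01_eq_diagonal, Matrix.mulVec_diagonal]
  · simp

lemma k_mul_kInv (pos : Bool) :
    Matrix.toLin' (kMat01 pos n) * Matrix.toLin' (kInvMat01 pos n) = 1 := by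
  have hv := vv_ne_zero
  have hs := sgn_mul_self pos
  refine LinearMap.ext fun x => ext_coord (fun i hi => ?_) (fun i hi => ?_)
  all_goals
    simp only [Module.End.mul_apply, Module.End.one_apply, coordZero_k, coordOne_k,
      coordZero_kInv, coordOne_kInv]
    rw [← mul_assoc, mul_mul_mul_comm, hs, one_mul, ← zpow_add₀ hv]
    simp

lemma kInv_mul_k (pos : Bool) :
    Matrix.toLin' (kInvMat01 pos n) * Matrix.toLin' (kMat01 pos n) = 1 :=
  mul_eq_one_comm.mp (k_mul_kInv pos)

lemma k_mul_e (pos : Bool) :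
    Matrix.toLin' (kMat01 pos n) * Matrix.toLin' (eMat01 pos n) =
      vv ^ 2 • (Matrix.toLin' (eMat01 pos n) * Matrix.toLin' (kMat01 pos n)) := by
  have hv := vv_ne_zero
  refine LinearMap.ext fun x => ext_coord (fun i hi => ?_) (fun i hi => ?_)
  all_goals
    simp only [Module.End.mul_apply, LinearMap.smul_apply, coordZero_k, coordOne_k,
      coordZero_e _ _ hi, coordOne_e _ _ hi, coordZero_smul, coordOne_smul]
    push_cast
    simp only [mul_add, mul_one, zpow_sub₀ hv, zpow_add₀ hv, zpow_one]
    simp only [zpow_ofNat]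
    field_simp
    try ring

lemma k_mul_f (pos : Bool) :
    Matrix.toLin' (kMat01 pos n) * Matrix.toLin' (fMat01 n) =
      vv ^ (-2 : ℤ) • (Matrix.toLin' (fMat01 n) * Matrix.toLin' (kMat01 pos n)) := by
  have hv := vv_ne_zero
  refine LinearMap.ext fun x => ext_coord (fun i hi => ?_) (fun i hi => ?_)
  · rcases i with _ | i
    · simp only [Module.End.mul_apply, LinearMap.smul_apply, coordZero_k, coordZero_f_zero,
        coordZero_smul, mul_zero]
    · simp only [Module.End.mul_apply, LinearMap.smul_apply, coordZero_k, coordZero_f_succ _ hi,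
        coordZero_smul]
      rw [show (n : ℤ) - 2 * ((i + 1 : ℕ) : ℤ) = -2 + (n - 2 * i) by push_cast; ring,
        zpow_add₀ hv]
      ring
  · have h2 : vv ^ ((n : ℤ) - 2 * (i + 1)) = vv ^ (-2 : ℤ) * vv ^ ((n : ℤ) - 2 * i) := by
      rw [← zpow_add₀ hv]
      ring_nf
    simp only [Module.End.mul_apply, LinearMap.smul_apply, coordOne_k, coordZero_k,
      coordOne_f _ hi, coordOne_smul]
    rcases i with _ | i
    · rw [h2]
      simp only [Nat.cast_zero, qn_zero]
      ring
    · rw [h2, Nat.add_sub_cancel]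
      push_cast
      ring

lemma inv_mul_k_sub_kInv (s : K) (m : ℤ) :
    (vv - vv⁻¹)⁻¹ * (s * vv ^ m - s * vv ^ (-m)) = s * qn m := by
  rw [qn]; ring

lemma e_mul_f_sub (pos : Bool) :
    Matrix.toLin' (eMat01 pos n) * Matrix.toLin' (fMat01 n) -
        Matrix.toLin' (fMat01 n) * Matrix.toLin' (eMat01 pos n) =
      (vv - vv⁻¹)⁻¹ • (Matrix.toLin' (kMat01 pos n) - Matrix.toLin' (kInvMat01 pos n)) := by
  have hv := vv_ne_zero
  refine LinearMap.ext fun x => ext_coord (fun i hi => ?_) (fun i hi => ?_)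
  · have hq : qn (i + 1) ≠ 0 := mod_cast qn_ne_zero i.succ_ne_zero
    have hk : (vv - vv⁻¹)⁻¹ * (sgn pos * vv ^ ((n : ℤ) - 2 * i) -
        sgn pos * vv ^ (2 * (i : ℤ) - n)) = sgn pos * qn (n - 2 * i) := by
      rw [← inv_mul_k_sub_kInv, neg_sub]
    have h1 := qn_mul_sub i (n - i)
    have h2 := vv_mul_qn_add (n - i - i - 1)
    rw [show (n : ℤ) - i - i - 1 + 1 = n - 2 * i by ring] at h2
    have h3 : vv ^ ((i : ℤ) + 1 - n) * vv ^ (i : ℤ) = vv ^ (-((n : ℤ) - i - i - 1)) := by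
      rw [← zpow_add₀ hv]
      ring_nf
    have h4 : vv ^ ((i : ℤ) + 1 - n) * vv⁻¹ = vv ^ ((i : ℤ) - n) := by
      rw [← zpow_neg_one, ← zpow_add₀ hv]
      ring_nf
    simp only [Module.End.mul_apply, LinearMap.sub_apply, LinearMap.smul_apply, coordZero_sub,
      coordZero_smul, coordZero_k, coordZero_kInv, coordZero_f_e pos x hi, coordZero_e pos _ hi,
      coordOne_f x hi]
    rw [← sub_mul, ← mul_assoc, hk, mul_assoc _ (qn _) (coordZero _ _), qn_mul_coordZero_f x hi,
      ← h2, ← h1, ← h3, ← h4]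
    field_simp
    ring
  · have hq : qn (i + 1) ≠ 0 := mod_cast qn_ne_zero i.succ_ne_zero
    have hq2 : qn (i + 2) ≠ 0 := mod_cast qn_ne_zero (i + 1).succ_ne_zero
    have hk : (vv - vv⁻¹)⁻¹ * (sgn pos * vv ^ ((n : ℤ) - 2 * (i + 1)) -
        sgn pos * vv ^ (2 * ((i : ℤ) + 1) - n)) = sgn pos * qn (n - 2 * (i + 1)) := by
      rw [← inv_mul_k_sub_kInv, neg_sub]
    have h1 := qn_mul_sub i (n - i)
    have h2 := inv_mul_qn_sub (n - i - i - 1)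
    rw [show (n : ℤ) - i - i - 1 - 1 = n - 2 * (i + 1) by ring] at h2
    have h3 : vv ^ (i : ℤ) * vv ^ ((i : ℤ) + 1 - n) = vv ^ (-((n : ℤ) - i - i - 1)) := by
      rw [← zpow_add₀ hv]
      ring_nf
    have h4 : vv ^ ((i : ℤ) + 1) = vv ^ (i : ℤ) * vv := zpow_add_one₀ hv _
    have he : vv⁻¹ * qn i / qn (i + 1) *
        coordOne (Matrix.toLin' (eMat01 pos n) x) (i - 1) =
        vv⁻¹ * qn i * (sgn pos * qn (n - i) * coordOne x i) := by
      have h5 := qn_mul_coordOne_e pos x hi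
      field_simp
      linear_combination h5
    simp only [Module.End.mul_apply, LinearMap.sub_apply, LinearMap.smul_apply, coordOne_sub,
      coordOne_smul, coordOne_k, coordOne_kInv, coordOne_e pos _ hi, coordOne_f _ hi,
      coordZero_e pos _ hi]
    rw [← sub_mul, ← mul_assoc, hk, mul_assoc _ (qn _) (coordOne _ _), qn_mul_coordOne_f x hi, he,
      ← h2, ← h1, ← h3, h4]
    field_simp
    ring

lemma l_mul_l : Matrix.toLin' (lMat01 n) * Matrix.toLin' (lMat01 n) = Matrix.toLin' (lMat01 n) := by
  refine LinearMap.ext fun x => ext_coord (fun i hi => ?_) (fun i hi => ?_) <;>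
    simp only [Module.End.mul_apply, coordZero_l, coordOne_l]

lemma k_mul_l (pos : Bool) : Matrix.toLin' (kMat01 pos n) * Matrix.toLin' (lMat01 n) =
    Matrix.toLin' (lMat01 n) * Matrix.toLin' (kMat01 pos n) := by
  refine LinearMap.ext fun x => ext_coord (fun i hi => ?_) (fun i hi => ?_) <;>
    simp only [Module.End.mul_apply, coordZero_l, coordOne_l, coordZero_k, coordOne_k, mul_zero]

lemma l_mul_e_mul_l (pos : Bool) :
    Matrix.toLin' (lMat01 n) * Matrix.toLin' (eMat01 pos n) * Matrix.toLin' (lMat01 n) =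
      Matrix.toLin' (lMat01 n) * Matrix.toLin' (eMat01 pos n) := by
  refine LinearMap.ext fun x => ext_coord (fun i hi => ?_) (fun i hi => ?_) <;>
    simp only [Module.End.mul_apply, coordZero_l, coordOne_l, coordOne_e _ _ hi]

lemma l_mul_f_mul_l :
    Matrix.toLin' (lMat01 n) * Matrix.toLin' (fMat01 n) * Matrix.toLin' (lMat01 n) =
      Matrix.toLin' (fMat01 n) * Matrix.toLin' (lMat01 n) := by
  refine LinearMap.ext fun x => ext_coord (fun i hi => ?_) (fun i hi => ?_)
  · rcases i with _ | i
    · simp only [Module.End.mul_apply, coordZero_l, coordZero_f_zero]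
    · simp only [Module.End.mul_apply, coordZero_l, coordZero_f_succ _ hi]
  · simp only [Module.End.mul_apply, coordOne_l]

lemma e_mul_l_mul_e (pos : Bool) :
    (vv + vv⁻¹) • (Matrix.toLin' (eMat01 pos n) * Matrix.toLin' (lMat01 n) *
        Matrix.toLin' (eMat01 pos n)) =
      vv⁻¹ • (Matrix.toLin' (eMat01 pos n) * Matrix.toLin' (eMat01 pos n) *
        Matrix.toLin' (lMat01 n)) +
      vv • (Matrix.toLin' (lMat01 n) *
        (Matrix.toLin' (eMat01 pos n) * Matrix.toLin' (eMat01 pos n))) := by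
  have hv := vv_ne_zero
  refine LinearMap.ext fun x => ext_coord (fun i hi => ?_) (fun i hi => ?_)
  · simp only [Module.End.mul_apply, LinearMap.smul_apply, LinearMap.add_apply, coordZero_smul,
      coordZero_add, coordZero_l, coordOne_l, coordZero_e _ _ hi]
    rcases Nat.lt_or_ge (i + 1) n with h | h
    · simp only [coordZero_e _ _ h, coordOne_e _ _ hi, coordZero_l, coordOne_l]
      push_cast
      have h2 : (i : ℤ) + 1 + 1 = i + 2 := by ring
      simp only [h2, zpow_add₀ hv, zpow_sub₀ hv, zpow_one]
      simp only [zpow_ofNat]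
      field_simp
      ring
    · simp only [coordZero_of_le _ h, coordOne_e _ _ hi, coordOne_of_le _ h]
      ring
  · simp only [Module.End.mul_apply, LinearMap.smul_apply, LinearMap.add_apply, coordOne_smul,
      coordOne_add, coordOne_l, coordOne_e _ _ hi]
    rcases Nat.lt_or_ge (i + 1) n with h | h
    · simp only [coordOne_e _ _ h, coordOne_l]
      ring
    · simp only [coordOne_of_le _ h]
      ring

lemma f_mul_l_mul_f :
    (vv + vv⁻¹) • (Matrix.toLin' (fMat01 n) * Matrix.toLin' (lMat01 n) *
        Matrix.toLin' (fMat01 n)) =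
      vv⁻¹ • (Matrix.toLin' (lMat01 n) *
        (Matrix.toLin' (fMat01 n) * Matrix.toLin' (fMat01 n))) +
      vv • (Matrix.toLin' (fMat01 n) * Matrix.toLin' (fMat01 n) *
        Matrix.toLin' (lMat01 n)) := by
  have hv := vv_ne_zero
  refine LinearMap.ext fun x => ext_coord (fun i hi => ?_) (fun i hi => ?_)
  · simp only [Module.End.mul_apply, LinearMap.smul_apply, LinearMap.add_apply, coordZero_smul,
      coordZero_add, coordZero_l]
    rcases i with _ | i
    · simp only [coordZero_f_zero]
      ring
    · simp only [coordZero_f_succ _ hi]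
      rcases i with _ | i
      · simp only [coordZero_f_zero, coordZero_l]
        ring
      · simp only [coordZero_f_succ _ (Nat.lt_of_succ_lt hi), coordZero_l]
        ring
  · simp only [Module.End.mul_apply, LinearMap.smul_apply, LinearMap.add_apply, coordOne_smul,
      coordOne_add, coordOne_l, coordOne_f _ hi, coordZero_l]
    rcases i with _ | i
    · simp only [coordZero_f_zero, Nat.cast_zero, qn_zero]
      ring
    · have hi' : i < n := by omega
      have hq : qn (i + 1) ≠ 0 := mod_cast qn_ne_zero i.succ_ne_zero
      have hq2 : qn (i + 1 + 1) ≠ 0 := mod_cast qn_ne_zero (i + 1).succ_ne_zero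
      have hl : coordZero (Matrix.toLin' (fMat01 n) (Matrix.toLin' (lMat01 n) x)) (i + 1) = 0 := by
        rw [coordZero_f_succ _ hi, coordZero_l]
      rw [hl, Nat.add_sub_cancel]
      simp only [coordZero_f_succ _ hi, coordOne_f _ hi', coordZero_l, coordOne_l]
      push_cast
      rw [zpow_add_one₀ hv]
      field_simp
      ring

/-- The operators by which the generators act on `L^±(n,01)`. -/
def generatorAction (pos : Bool) (n : ℕ) : G5 → Module.End K (I01 n → K)
  | G5.e => Matrix.toLin' (eMat01 pos n)
  | G5.f => Matrix.toLin' (fMat01 n)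
  | G5.k => Matrix.toLin' (kMat01 pos n)
  | G5.k' => Matrix.toLin' (kInvMat01 pos n)
  | G5.l => Matrix.toLin' (lMat01 n)

lemma lift_generatorAction_eq (pos : Bool) (n : ℕ) ⦃a b : FreeAlgebra K G5⦄ (h : Rel a b) :
    FreeAlgebra.lift K (generatorAction pos n) a =
      FreeAlgebra.lift K (generatorAction pos n) b := by
  cases h <;>
    simp only [map_mul, map_add, map_sub, map_smul, map_one, FreeAlgebra.lift_ι_apply,
      generatorAction]
  case kk' => exact k_mul_kInv pos
  case k'k => exact kInv_mul_k pos
  case kek' => rw [k_mul_e, smul_mul_assoc, mul_assoc, k_mul_kInv, mul_one]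
  case kfk' => rw [k_mul_f, smul_mul_assoc, mul_assoc, k_mul_kInv, mul_one]
  case effe => exact e_mul_f_sub pos
  case ll => exact l_mul_l
  case kl => exact k_mul_l pos
  case lel => exact l_mul_e_mul_l pos
  case lfl => exact l_mul_f_mul_l
  case serreE => exact e_mul_l_mul_e pos
  case serreF => exact f_mul_l_mul_f

/-- Proposition 5.3: the formulas for the actions of `e, f, k, ℓ` on the basis
`{m_{i,0}} ∪ {m_{j,1}}` define a representation of `MU_v(2)` on the `2n`-dimensional
space `L^±(n,01)`, i.e. there is a `K`-algebra homomorphism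
`MU_v(2) → End_K(L^±(n,01))` sending the generators to the given operators. -/
theorem L01_module_structure (pos : Bool) (n : ℕ) (hn : 1 ≤ n) :
    ∃ ρ : MU2 →ₐ[K] Module.End K (I01 n → K),
      ρ Ee = Matrix.toLin' (eMat01 pos n) ∧
      ρ Ff = Matrix.toLin' (fMat01 n) ∧
      ρ Kk = Matrix.toLin' (kMat01 pos n) ∧
      ρ Ll = Matrix.toLin' (lMat01 n) := by
  refine ⟨RingQuot.liftAlgHom K ⟨FreeAlgebra.lift K (generatorAction pos n),
    lift_generatorAction_eq pos n⟩, ?_, ?_, ?_, ?_⟩ <;>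
    simp [Ee, Ff, Kk, Ll, generatorAction]

end

end MirabolicSL2
end
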